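/- arXiv:0807.1079 — 3 statements merged into one kernel-verified Lean document; each statement's English description precedes it below -/
import Mathlib

section
/- Let α, β ∈ [0, r] ∩ A with α < β, and set I = (α, β). Let x ∈ F_I(r,Λ,A) satisfy fix(x) ∩ I ∩ A = ∅. Then the centralizer of x in F_I(r,Λ,A) is a cyclic group. -/
open Set

noncomputable section

/-- The multiplicative group of positive real numbers. -/
abbrev PosReal : Type := {x : ℝ // 0 < x}

namespace ThompsonStein

/-- The support of a permutation of `ℝ`: the set of non-fixed points. -/
def supp (f : Equiv.Perm ℝ) : Set ℝ := {t | f t ≠ t}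

/-- The fixed-point set of a permutation of `ℝ`. -/
def fixSet (f : Equiv.Perm ℝ) : Set ℝ := {t | f t = t}

/-- Membership in the Stein–Thompson group `F(r, Λ, A)`, where elements of the group of
piecewise affine homeomorphisms of `[0, r)` are encoded as the permutations of `ℝ` fixing
every point outside `[0, r)`.  The conditions say: `f` fixes the complement of `[0, r)`
(so it restricts to a bijection of `[0, r)`), it is strictly increasing and continuous on
`[0, r)`, and it is piecewise affine with respect to a finite subdivision
`0 = t 0 < t 1 < ⋯ < t n = r` whose points and their images lie in `A`, the slope of each
affine piece lying in `Λ`. -/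
def MemF (r : ℝ) (Λ : Subgroup PosReal) (A : AddSubgroup ℝ) (f : Equiv.Perm ℝ) : Prop :=
  (∀ t : ℝ, t ∉ Set.Ico 0 r → f t = t) ∧
  StrictMonoOn f (Set.Ico 0 r) ∧
  ContinuousOn f (Set.Ico 0 r) ∧
  ∃ n : ℕ, ∃ t : Fin (n + 1) → ℝ,
    StrictMono t ∧ t 0 = 0 ∧ t (Fin.last n) = r ∧
    (∀ i, t i ∈ A) ∧ (∀ i, f (t i) ∈ A) ∧
    ∀ i : Fin n, ∃ s : PosReal, s ∈ Λ ∧ ∃ c : ℝ,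
      ∀ u ∈ Set.Icc (t i.castSucc) (t i.succ), f u = (s : ℝ) * u + c

/-- Membership in `F_S(r, Λ, A)`: the elements of `F(r, Λ, A)` with support contained
in `S`. -/
def MemFOn (r : ℝ) (Λ : Subgroup PosReal) (A : AddSubgroup ℝ) (S : Set ℝ)
    (f : Equiv.Perm ℝ) : Prop :=
  MemF r Λ A f ∧ supp f ⊆ S

/-- `f` has right slope `s` at `γ`:  `f` is affine with slope `s` on some interval
`(γ, γ + ε)` to the right of `γ`. -/
def HasRightSlope (f : ℝ → ℝ) (γ s : ℝ) : Prop :=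
  ∃ ε > (0 : ℝ), ∃ c : ℝ, ∀ u ∈ Set.Ioo γ (γ + ε), f u = s * u + c

/-- `f` has left slope `s` at `γ`:  `f` is affine with slope `s` on some interval
`(γ - ε, γ)` to the left of `γ`. -/
def HasLeftSlope (f : ℝ → ℝ) (γ s : ℝ) : Prop :=
  ∃ ε > (0 : ℝ), ∃ c : ℝ, ∀ u ∈ Set.Ioo (γ - ε) γ, f u = s * u + c

end ThompsonStein

namespace ThompsonStein

open Filter Topology

/-- A function that is locally affine on an open interval agrees on the whole interval with any
affine function it agrees with near one of the points. -/
lemma eq_affine_of_locally_affine {g : ℝ → ℝ} {p q m s c : ℝ} (hm : m ∈ Ioo p q)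
    (hgm : ∀ᶠ v in 𝓝 m, g v = s * v + c)
    (hg : ∀ u ∈ Ioo p q, ∃ s' c' : ℝ, ∀ᶠ v in 𝓝 u, g v = s' * v + c') :
    ∀ u ∈ Ioo p q, g u = s * u + c := by
  have key : ∀ {u s' c' : ℝ}, (∀ᶠ v in 𝓝 u, g v = s' * v + c') → HasDerivAt g s' u := by
    intro u s' c' h
    have h1 : HasDerivAt (fun v : ℝ => s' * v + c') s' u := by
      simpa using ((hasDerivAt_id u).const_mul s').add_const c'
    exact h1.congr_of_eventuallyEq h
  have hd : DifferentiableOn ℝ g (Ioo p q) := fun u hu => by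
    obtain ⟨s', c', h⟩ := hg u hu
    exact (key h).differentiableAt.differentiableWithinAt
  have hderiv : ∀ u ∈ Ioo p q, DifferentiableAt ℝ (deriv g) u ∧ deriv (deriv g) u = 0 := by
    intro u hu
    obtain ⟨s', c', h⟩ := hg u hu
    have h2 : deriv g =ᶠ[𝓝 u] fun _ => s' :=
      h.eventually_nhds.mono fun v hv => (key hv).deriv
    have h3 : HasDerivAt (deriv g) 0 u := (hasDerivAt_const u s').congr_of_eventuallyEq h2
    exact ⟨h3.differentiableAt, h3.deriv⟩
  have hds : ∀ u ∈ Ioo p q, deriv g u = s := by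
    intro u hu
    rw [← (key hgm).deriv]
    exact isOpen_Ioo.is_const_of_deriv_eq_zero isPreconnected_Ioo
      (fun v hv => (hderiv v hv).1.differentiableWithinAt) (fun v hv => (hderiv v hv).2) hu hm
  have hlin : ∀ u : ℝ, HasDerivAt (fun v : ℝ => s * v + c) s u := fun u => by
    simpa using ((hasDerivAt_id u).const_mul s).add_const c
  exact isOpen_Ioo.eqOn_of_deriv_eq isPreconnected_Ioo hd
    (fun u _ => (hlin u).differentiableAt.differentiableWithinAt)
    (fun u hu => by rw [hds u hu, (hlin u).deriv]) hm hgm.self_of_nhds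

/-- A function that is affine with slope in `Λ` near `t`. -/
def LocallyAffineAt (Λ : Subgroup PosReal) (f : ℝ → ℝ) (t : ℝ) : Prop :=
  ∃ s ∈ Λ, ∃ c : ℝ, ∀ᶠ u in 𝓝 t, f u = (s : ℝ) * u + c

lemma continuous_of_strictMono_perm {f : Equiv.Perm ℝ} (hf : StrictMono f) : Continuous f :=
  hf.monotone.continuous_of_surjective f.surjective

lemma strictMono_inv {f : Equiv.Perm ℝ} (hf : StrictMono f) : StrictMono (f⁻¹ : Equiv.Perm ℝ) := by
  intro a b hab
  rw [← hf.lt_iff_lt]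
  simpa using hab

/-- The group of increasing piecewise affine permutations of `ℝ` with slopes in `Λ` and finitely
many breakpoints, all in `A`, that preserve `A`. -/
def plGroup (Λ : Subgroup PosReal) (A : AddSubgroup ℝ) : Subgroup (Equiv.Perm ℝ) where
  carrier := {f | StrictMono f ∧ (∀ a, f a ∈ A ↔ a ∈ A) ∧
    ∃ B : Set ℝ, B.Finite ∧ B ⊆ A ∧ ∀ t ∉ B, LocallyAffineAt Λ f t}
  one_mem' := ⟨strictMono_id, fun _ => Iff.rfl, ∅, finite_empty, empty_subset _,
    fun t _ => ⟨1, one_mem _, 0, by simp⟩⟩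
  mul_mem' := by
    rintro f g ⟨hf, hfA, B, hB, hBA, hfB⟩ ⟨hg, hgA, B', hB', hBA', hgB⟩
    refine ⟨hf.comp hg, fun a => by simp [hfA, hgA], B' ∪ g ⁻¹' B,
      hB'.union (hB.preimage g.injective.injOn), ?_, ?_⟩
    · rintro b (hb | hb)
      · exact hBA' hb
      · exact (hgA b).1 (hBA hb)
    · intro t ht
      simp only [mem_union, mem_preimage, not_or] at ht
      obtain ⟨s, hs, c, h⟩ := hfB _ ht.2
      obtain ⟨s', hs', c', h'⟩ := hgB _ ht.1
      refine ⟨s * s', mul_mem hs hs', s * c' + c, ?_⟩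
      filter_upwards [h', (continuous_of_strictMono_perm hg).continuousAt.eventually h]
        with u hu hu'
      rw [Equiv.Perm.mul_apply, hu', hu]
      push_cast [Positive.val_mul]
      ring
  inv_mem' := by
    rintro f ⟨hf, hfA, B, hB, hBA, hfB⟩
    refine ⟨strictMono_inv hf, fun a => by rw [← hfA]; simp, f '' B, hB.image f, ?_, ?_⟩
    · rintro _ ⟨b, hb, rfl⟩
      exact (hfA b).2 (hBA hb)
    · intro t ht
      have ht' : f⁻¹ t ∉ B := fun h => ht ⟨_, h, by simp⟩
      obtain ⟨s, hs, c, h⟩ := hfB _ ht'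
      refine ⟨s⁻¹, inv_mem hs, -(s : ℝ)⁻¹ * c, ?_⟩
      filter_upwards [(continuous_of_strictMono_perm (strictMono_inv hf)).continuousAt.eventually h]
        with u hu
      have hs0 : (s : ℝ) ≠ 0 := s.2.ne'
      have : u = s * f⁻¹ u + c := by simpa using hu
      rw [Positive.coe_inv]
      field_simp
      linarith

/-- The permutations in `plGroup Λ A` supported in the open interval `(α, β)`. -/
def plGroupOn (Λ : Subgroup PosReal) (A : AddSubgroup ℝ) (α β : ℝ) : Subgroup (Equiv.Perm ℝ) where
  carrier := {f | f ∈ plGroup Λ A ∧ ∀ t ∉ Ioo α β, f t = t}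
  one_mem' := ⟨one_mem _, fun _ _ => rfl⟩
  mul_mem' := fun hf hg => ⟨mul_mem hf.1 hg.1, fun t ht => by
    rw [Equiv.Perm.mul_apply, hg.2 t ht, hf.2 t ht]⟩
  inv_mem' := fun hf => ⟨inv_mem hf.1, fun t ht => by
    rw [Equiv.Perm.inv_eq_iff_eq, hf.2 t ht]⟩

variable {Λ : Subgroup PosReal} {A : AddSubgroup ℝ} {α β : ℝ} {x y f : Equiv.Perm ℝ}

/-- An element of `plGroup Λ A` is affine on each closed interval whose interior contains no
breakpoint. -/
lemma exists_affine_on_Icc {B : Set ℝ} (hf : StrictMono f)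
    (hB : ∀ t ∉ B, LocallyAffineAt Λ f t) {p q : ℝ} (hpq : p < q)
    (hd : ∀ t ∈ Ioo p q, t ∉ B) :
    ∃ s ∈ Λ, ∃ c : ℝ, ∀ u ∈ Icc p q, f u = (s : ℝ) * u + c := by
  have hm : (p + q) / 2 ∈ Ioo p q := ⟨by linarith, by linarith⟩
  obtain ⟨s, hs, c, h⟩ := hB _ (hd _ hm)
  have h1 := eq_affine_of_locally_affine hm h fun u hu => by
    obtain ⟨s, _, c, h⟩ := hB _ (hd _ hu)
    exact ⟨s, c, h⟩
  refine ⟨s, hs, c, fun u hu => ?_⟩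
  rw [← closure_Ioo hpq.ne] at hu
  exact EqOn.closure (s := Ioo p q) (f := f) (g := fun u => (s : ℝ) * u + c) h1
    (continuous_of_strictMono_perm hf) (by fun_prop) hu

lemma exists_right_affine (hf : f ∈ plGroup Λ A) (p : ℝ) :
    ∃ q > p, ∃ s ∈ Λ, ∀ u ∈ Icc p q, f u = f p + (s : ℝ) * (u - p) := by
  obtain ⟨hm, -, B, hB, -, hBl⟩ := hf
  have h1 : (B \ {p})ᶜ ∈ 𝓝[>] p :=
    nhdsWithin_le_nhds ((hB.subset sdiff_subset).isClosed.isOpen_compl.mem_nhds (by simp))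
  obtain ⟨q, hq, hsub⟩ := mem_nhdsGT_iff_exists_Ioo_subset.1 h1
  obtain ⟨s, hs, c, h⟩ := exists_affine_on_Icc hm hBl (mem_Ioi.1 hq) fun t ht htB =>
    hsub ht ⟨htB, ht.1.ne'⟩
  refine ⟨q, hq, s, hs, fun u hu => ?_⟩
  rw [h u hu, h p ⟨le_rfl, (mem_Ioi.1 hq).le⟩]
  ring

lemma exists_left_affine (hf : f ∈ plGroup Λ A) (p : ℝ) :
    ∃ q < p, ∃ s ∈ Λ, ∀ u ∈ Icc q p, f u = f p + (s : ℝ) * (u - p) := by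
  obtain ⟨hm, -, B, hB, -, hBl⟩ := hf
  have h1 : (B \ {p})ᶜ ∈ 𝓝[<] p :=
    nhdsWithin_le_nhds ((hB.subset sdiff_subset).isClosed.isOpen_compl.mem_nhds (by simp))
  obtain ⟨q, hq, hsub⟩ := mem_nhdsLT_iff_exists_Ioo_subset.1 h1
  obtain ⟨s, hs, c, h⟩ := exists_affine_on_Icc hm hBl (mem_Iio.1 hq) fun t ht htB =>
    hsub ht ⟨htB, ht.2.ne⟩
  refine ⟨q, hq, s, hs, fun u hu => ?_⟩
  rw [h u hu, h p ⟨(mem_Iio.1 hq).le, le_rfl⟩]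
  ring

lemma exists_mem_piece {n : ℕ} {t : Fin (n + 1) → ℝ} {u : ℝ} (h0 : t 0 ≤ u)
    (hu : u < t (Fin.last n)) : ∃ i : Fin n, t i.castSucc ≤ u ∧ u < t i.succ := by
  by_contra! hcon
  have h : ∀ i : Fin (n + 1), t i ≤ u := fun i => Fin.induction h0 hcon i
  exact absurd (h (Fin.last n)) (not_le.2 hu)

lemma mem_plGroupOn_of_memFOn {r : ℝ}
    (hΛA : ∀ s : PosReal, s ∈ Λ → ∀ a : ℝ, a ∈ A → (s : ℝ) * a ∈ A)
    (hf : MemFOn r Λ A (Ioo α β) f) : f ∈ plGroupOn Λ A α β := by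
  obtain ⟨⟨hout, hmono, -, n, t, ht, ht0, htn, htA, hftA, hpiece⟩, hsupp⟩ := hf
  have hmaps : ∀ u ∈ Ico 0 r, f u ∈ Ico 0 r := by
    intro u hu
    by_contra hfu
    exact hfu (by rwa [f.injective (hout _ hfu)])
  have hstrict : StrictMono f := by
    intro u v huv
    by_cases hu : u ∈ Ico 0 r <;> by_cases hv : v ∈ Ico 0 r
    · exact hmono hu hv huv
    · rw [hout v hv]
      have : r ≤ v := by
        by_contra! h
        exact hv ⟨hu.1.trans huv.le, h⟩
      exact (hmaps u hu).2.trans_le this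
    · rw [hout u hu]
      have : u < 0 := by
        by_contra! h
        exact hu ⟨h, huv.trans hv.2⟩
      exact this.trans_le (hmaps v hv).1
    · rwa [hout u hu, hout v hv]
  refine ⟨⟨hstrict, fun a => ?_, range t, finite_range t, ?_, ?_⟩, ?_⟩
  · by_cases ha : a ∈ Ico 0 r
    · obtain ⟨i, hi1, hi2⟩ := exists_mem_piece (t := t) (ht0.trans_le ha.1) (htn ▸ ha.2)
      obtain ⟨s, hs, c, h⟩ := hpiece i
      have hdiff : f a = f (t i.castSucc) + s * (a - t i.castSucc) := by
        rw [h a ⟨hi1, hi2.le⟩, h _ ⟨le_rfl, hi1.trans hi2.le⟩]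
        ring
      constructor
      · intro hfa
        have h1 := hΛA _ (inv_mem hs) _ (sub_mem hfa (hftA i.castSucc))
        rw [hdiff, add_sub_cancel_left, Positive.coe_inv, inv_mul_cancel_left₀ s.2.ne'] at h1
        simpa using add_mem h1 (htA i.castSucc)
      · intro haA
        rw [hdiff]
        exact add_mem (hftA _) (hΛA _ hs _ (sub_mem haA (htA _)))
    · rw [hout a ha]
  · rintro _ ⟨i, rfl⟩
    exact htA i
  · intro u hu
    have hne : ∀ i, t i ≠ u := fun i hi => hu ⟨i, hi⟩
    by_cases hu' : u ∈ Ico 0 r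
    · obtain ⟨i, hi1, hi2⟩ := exists_mem_piece (t := t) (ht0.trans_le hu'.1) (htn ▸ hu'.2)
      obtain ⟨s, hs, c, h⟩ := hpiece i
      refine ⟨s, hs, c, ?_⟩
      filter_upwards [Ioo_mem_nhds (lt_of_le_of_ne hi1 (hne _)) hi2] with v hv
      exact h v (Ioo_subset_Icc_self hv)
    · have : u ∈ (Icc 0 r)ᶜ := by
        intro h
        rcases h.2.lt_or_eq with h2 | h2
        · exact hu' ⟨h.1, h2⟩
        · exact hne (Fin.last n) (htn.trans h2.symm)
      refine ⟨1, one_mem _, 0, ?_⟩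
      filter_upwards [isClosed_Icc.isOpen_compl.mem_nhds this] with v hv
      rw [hout v fun h => hv (Ico_subset_Icc_self h)]
      simp
  · intro u hu
    by_contra h
    exact hu (hsupp h)

lemma memFOn_of_mem_plGroupOn {r : ℝ} (hr : 0 < r) (hrA : r ∈ A) (hα : 0 ≤ α) (hβ : β ≤ r)
    (hf : f ∈ plGroupOn Λ A α β) : MemFOn r Λ A (Ioo α β) f := by
  obtain ⟨⟨hm, hfA, B, hB, hBA, hBl⟩, hout⟩ := hf
  refine ⟨⟨fun t ht => hout t fun h => ht ⟨hα.trans h.1.le, h.2.trans_le hβ⟩, hm.strictMonoOn _,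
    (continuous_of_strictMono_perm hm).continuousOn, ?_⟩, fun t ht => ?_⟩
  · set S : Finset ℝ := (hB.inter_of_left (Icc 0 r)).toFinset ∪ {0, r} with hS
    have hmem : ∀ b, b ∈ S ↔ (b ∈ B ∧ b ∈ Icc 0 r) ∨ b = 0 ∨ b = r := by
      intro b
      simp [hS]
      tauto
    have hIcc : ∀ b ∈ S, 0 ≤ b ∧ b ≤ r := by
      intro b hb
      rcases (hmem b).1 hb with h | rfl | rfl
      · exact h.2
      · exact ⟨le_rfl, hr.le⟩
      · exact ⟨hr.le, le_rfl⟩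
    have hSA : ∀ b ∈ S, b ∈ A := by
      intro b hb
      rcases (hmem b).1 hb with h | rfl | rfl
      · exact hBA h.1
      · exact zero_mem _
      · exact hrA
    have h0S : 0 ∈ S := (hmem 0).2 (by simp)
    have hrS : r ∈ S := (hmem r).2 (by simp)
    obtain ⟨n, hn⟩ : ∃ n, S.card = n + 1 :=
      Nat.exists_eq_succ_of_ne_zero (Finset.card_ne_zero_of_mem h0S)
    set t := S.orderEmbOfFin hn with htdef
    have htS : ∀ i, t i ∈ S := S.orderEmbOfFin_mem hn
    have hrange : ∀ b ∈ S, ∃ i, t i = b := fun b hb => by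
      have : b ∈ range t := by rw [htdef, Finset.range_orderEmbOfFin]; exact hb
      exact this
    refine ⟨n, t, t.strictMono, ?_, ?_, fun i => hSA _ (htS i), fun i => (hfA _).2 (hSA _ (htS i)),
      fun i => ?_⟩
    · obtain ⟨i, hi⟩ := hrange 0 h0S
      exact le_antisymm (hi ▸ t.monotone (Fin.zero_le i)) (hIcc _ (htS 0)).1
    · obtain ⟨i, hi⟩ := hrange r hrS
      exact le_antisymm (hIcc _ (htS _)).2 (hi ▸ t.monotone (Fin.le_last i))
    · obtain ⟨s, hs, c, h⟩ := exists_affine_on_Icc hm hBl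
        (t.strictMono (Fin.castSucc_lt_succ (i := i))) fun v hv hvB => by
          have hvS : v ∈ S := (hmem v).2 (Or.inl ⟨hvB, (hIcc _ (htS _)).1.trans hv.1.le,
            hv.2.le.trans (hIcc _ (htS _)).2⟩)
          obtain ⟨j, rfl⟩ := hrange v hvS
          have h1 := t.lt_iff_lt.1 hv.1
          have h2 := t.lt_iff_lt.1 hv.2
          rw [Fin.lt_def] at h1 h2
          simp at h1 h2
          omega
      exact ⟨s, hs, c, h⟩
  · by_contra h
    exact ht (hout t h)

lemma strictMono_of_mem (hf : f ∈ plGroupOn Λ A α β) : StrictMono f := hf.1.1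

lemma apply_left_endpoint (hf : f ∈ plGroupOn Λ A α β) : f α = α :=
  hf.2 α fun h => lt_irrefl _ h.1

lemma apply_right_endpoint (hf : f ∈ plGroupOn Λ A α β) : f β = β :=
  hf.2 β fun h => lt_irrefl _ h.2

lemma apply_comm (h : Commute x y) (u : ℝ) : x (y u) = y (x u) :=
  congrArg (fun g : Equiv.Perm ℝ => g u) h.eq

/-- If `x` has no fixed point in `(α, β) ∩ A`, then an element commuting with `x` that is trivial
near `α` is trivial. -/
lemma eq_one_of_trivial_near (hx : x ∈ plGroupOn Λ A α β) (hy : y ∈ plGroupOn Λ A α β)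
    (hxy : Commute x y) (hfix : ∀ t ∈ Ioo α β, t ∈ A → x t ≠ t) {q : ℝ} (hq : α < q)
    (hyq : ∀ u ∈ Ioo α q, y u = u) : y = 1 := by
  by_contra hne
  obtain ⟨t₀, ht₀⟩ : ∃ t, y t ≠ t := by
    by_contra! h
    exact hne (Equiv.ext h)
  set N := {t | α < t ∧ y t ≠ t} with hN
  have ht₀I : t₀ ∈ Ioo α β := by
    by_contra h
    exact ht₀ (hy.2 _ h)
  have hNne : N.Nonempty := ⟨t₀, ht₀I.1, ht₀⟩
  have hqN : ∀ t ∈ N, q ≤ t := fun t ht => by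
    by_contra! h
    exact ht.2 (hyq t ⟨ht.1, h⟩)
  have hbdd : BddBelow N := ⟨q, hqN⟩
  set σ := sInf N with hσ
  have hqσ : q ≤ σ := le_csInf hNne hqN
  have hασ : α < σ := hq.trans_le hqσ
  have hσβ : σ < β := (csInf_le hbdd ⟨ht₀I.1, ht₀⟩).trans_lt ht₀I.2
  have hbelow : ∀ u ∈ Ioo α σ, y u = u := fun u hu => by
    by_contra h
    exact notMem_of_lt_csInf hu.2 hbdd ⟨hu.1, h⟩
  have habove : ∀ η > σ, ¬ ∀ u ∈ Ico σ η, y u = u := by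
    intro η hη h
    obtain ⟨t, ht, htη⟩ := exists_lt_of_csInf_lt hNne hη
    exact ht.2 (h t ⟨csInf_le hbdd ht, htη⟩)
  have hpush : ∀ w ∈ plGroupOn Λ A α β, Commute w y → ¬ σ < w σ := by
    intro w hw hwy hlt
    refine habove _ hlt fun u hu => ?_
    have hm := strictMono_of_mem hw
    have h1 : y (w⁻¹ u) = w⁻¹ u := by
      refine hbelow _ ⟨?_, ?_⟩
      · rw [← hm.lt_iff_lt, apply_left_endpoint hw]
        simpa using hασ.trans_le hu.1
      · rw [← hm.lt_iff_lt]
        simpa using hu.2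
    have h2 := apply_comm hwy (w⁻¹ u)
    rw [h1] at h2
    simpa using h2.symm
  rcases lt_trichotomy (x σ) σ with h | h | h
  · refine hpush x⁻¹ (inv_mem hx) hxy.inv_left ?_
    rw [← (strictMono_of_mem hx).lt_iff_lt]
    simpa using h
  · obtain ⟨-, -, B, -, hBA, hBl⟩ := hy.1
    have hσB : σ ∉ B := fun hb => hfix σ ⟨hασ, hσβ⟩ (hBA hb) h
    obtain ⟨s, -, c, hs⟩ := hBl σ hσB
    obtain ⟨l, u, ⟨hl, hu⟩, hsub⟩ := mem_nhds_iff_exists_Ioo_subset.1 hs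
    set m := max l α with hm
    have hmσ : m < σ := max_lt hl hασ
    have hlin : ∀ v ∈ Ioo m σ, v = (s : ℝ) * v + c := fun v hv => by
      have h1 : y v = (s : ℝ) * v + c := hsub ⟨(le_max_left _ _).trans_lt hv.1, hv.2.trans hu⟩
      rw [← h1, hbelow v ⟨(le_max_right _ _).trans_lt hv.1, hv.2⟩]
    have h1 := hlin ((m + σ) / 2) ⟨by linarith, by linarith⟩
    have h2 := hlin ((m + 3 * σ) / 4) ⟨by linarith, by linarith⟩
    have h3 : ((s : ℝ) - 1) * (σ - m) = 0 := by linarith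
    have hs1 : (s : ℝ) = 1 := by
      rcases mul_eq_zero.1 h3 with h4 | h4 <;> linarith
    have hc : c = 0 := by rw [hs1] at h1; linarith
    refine habove u hu fun v hv => ?_
    have h4 : y v = (s : ℝ) * v + c := hsub ⟨hl.trans_le hv.1, hv.2⟩
    rw [h4, hs1, hc]
    ring
  · exact hpush x hx hxy h

lemma tendsto_right_of_mem (hf : f ∈ plGroupOn Λ A α β) : Tendsto f (𝓝[>] α) (𝓝[>] α) := by
  have hm := strictMono_of_mem hf
  have h0 := apply_left_endpoint hf
  refine tendsto_nhdsWithin_iff.2 ⟨?_, ?_⟩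
  · have := (continuous_of_strictMono_perm hm).tendsto α
    rw [h0] at this
    exact this.mono_left nhdsWithin_le_nhds
  · filter_upwards [self_mem_nhdsWithin] with u hu
    have := hm (mem_Ioi.1 hu)
    rwa [h0] at this

/-- The graph of the homomorphism sending an element of the centralizer of `x` to its right slope
at `α`. -/
def slopeGraph (Λ : Subgroup PosReal) (A : AddSubgroup ℝ) (α β : ℝ) (x : Equiv.Perm ℝ) :
    Subgroup (Equiv.Perm ℝ × PosReal) where
  carrier := {p | p.1 ∈ plGroupOn Λ A α β ∧ Commute x p.1 ∧
    ∀ᶠ u in 𝓝[>] α, p.1 u = α + (p.2 : ℝ) * (u - α)}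
  one_mem' := ⟨one_mem _, Commute.one_right x, by simp⟩
  mul_mem' := by
    rintro p p' ⟨h1, h2, h3⟩ ⟨h1', h2', h3'⟩
    refine ⟨mul_mem h1 h1', h2.mul_right h2', ?_⟩
    filter_upwards [h3', (tendsto_right_of_mem h1').eventually h3] with u hu hu'
    rw [Prod.fst_mul, Prod.snd_mul, Equiv.Perm.mul_apply, hu', hu, Positive.val_mul]
    ring
  inv_mem' := by
    rintro p ⟨h1, h2, h3⟩
    refine ⟨inv_mem h1, h2.inv_right, ?_⟩
    filter_upwards [(tendsto_right_of_mem (inv_mem h1)).eventually h3] with u hu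
    have hs0 : (p.2 : ℝ) ≠ 0 := p.2.2.ne'
    have : u = α + (p.2 : ℝ) * (p.1⁻¹ u - α) := by simpa using hu
    rw [Prod.fst_inv, Prod.snd_inv, Positive.coe_inv]
    field_simp
    linarith

lemma exists_mem_slopeGraph (hy : y ∈ plGroupOn Λ A α β) (hxy : Commute x y) :
    ∃ s, (y, s) ∈ slopeGraph Λ A α β x := by
  obtain ⟨q, hq, s, -, h⟩ := exists_right_affine hy.1 α
  rw [apply_left_endpoint hy] at h
  refine ⟨s, hy, hxy, ?_⟩
  filter_upwards [Ioo_mem_nhdsGT hq] with u hu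
  exact h u (Ioo_subset_Icc_self hu)

lemma eq_one_of_slope_eq_one (hx : x ∈ plGroupOn Λ A α β)
    (hfix : ∀ t ∈ Ioo α β, t ∈ A → x t ≠ t) (hy : (y, 1) ∈ slopeGraph Λ A α β x) : y = 1 := by
  obtain ⟨h1, h2, h3⟩ := hy
  obtain ⟨q, hq, hsub⟩ := mem_nhdsGT_iff_exists_Ioo_subset.1 h3
  refine eq_one_of_trivial_near hx h1 h2 hfix hq fun u hu => ?_
  have : y u = α + ((1 : PosReal) : ℝ) * (u - α) := hsub hu
  simpa using this

/-- An element of the centralizer of the increasing map `w` that is linear near a contracting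
fixed point `p` of `w` is linear on the whole domain of linearity of `w`. -/
lemma linear_of_linear_near {w y : Equiv.Perm ℝ} (hwy : Commute w y) {T : Set ℝ} {p k m δ : ℝ}
    (hk : 0 < k) (hk1 : k < 1) (hT : ∀ t ∈ T, k * t ∈ T) (hw : ∀ t ∈ T, w (p + t) = p + k * t)
    (hδ : 0 < δ) (hy : ∀ t ∈ T, |t| < δ → y (p + t) = p + m * t) {t : ℝ} (ht : t ∈ T)
    (hmt : m * t ∈ T) : y (p + t) = p + m * t := by
  have hpow : ∀ (n : ℕ), ∀ t ∈ T, k ^ n * t ∈ T ∧ (w ^ n) (p + t) = p + k ^ n * t := by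
    intro n
    induction n with
    | zero => simp
    | succ n ih =>
      intro t ht
      obtain ⟨h1, h2⟩ := ih t ht
      refine ⟨by rw [pow_succ', mul_assoc]; exact hT _ h1, ?_⟩
      rw [pow_succ', Equiv.Perm.mul_apply, h2, hw _ h1, pow_succ', mul_assoc]
  obtain ⟨n, hn⟩ : ∃ n : ℕ, |k ^ n * t| < δ := by
    have : Tendsto (fun n : ℕ => |k ^ n * t|) atTop (𝓝 0) := by
      simpa using ((tendsto_pow_atTop_nhds_zero_of_lt_one hk.le hk1).mul_const t).abs
    exact (this.eventually (gt_mem_nhds hδ)).exists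
  obtain ⟨h1, h2⟩ := hpow n t ht
  apply (w ^ n).injective
  rw [apply_comm (hwy.pow_left n), h2, hy _ h1 hn, (hpow n _ hmt).2]
  ring

/-- Iterating an increasing map without fixed points in `[p, γ)` pushes `p` towards `γ`. -/
lemma exists_lt_pow_apply {h : Equiv.Perm ℝ} (hm : StrictMono h) {p γ : ℝ} (hpγ : p < γ)
    (hγ : h γ = γ) (hlt : ∀ u ∈ Ico p γ, u < h u) {q : ℝ} (hq : q < γ) :
    ∃ n : ℕ, q < (h ^ n) p := by
  by_contra! hcon
  have hmem : ∀ n : ℕ, (h ^ n) p ∈ Ico p γ := by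
    intro n
    induction n with
    | zero => exact ⟨le_rfl, hpγ⟩
    | succ n ih =>
      rw [pow_succ', Equiv.Perm.mul_apply]
      exact ⟨ih.1.trans (hlt _ ih).le, hγ ▸ hm ih.2⟩
  have hmono : Monotone fun n : ℕ => (h ^ n) p := monotone_nat_of_le_succ fun n => by
    rw [pow_succ', Equiv.Perm.mul_apply]
    exact (hlt _ (hmem n)).le
  have hbdd : BddAbove (range fun n : ℕ => (h ^ n) p) := ⟨q, by rintro _ ⟨n, rfl⟩; exact hcon n⟩
  have hlim := tendsto_atTop_ciSup hmono hbdd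
  set L := ⨆ n : ℕ, (h ^ n) p
  have hLq : L ≤ q := ciSup_le hcon
  have hpL : p ≤ L := (hmem 0).1.trans (le_ciSup hbdd 0)
  have h1 := (hlim.comp (tendsto_add_atTop_nat 1))
  have h2 := ((continuous_of_strictMono_perm hm).tendsto L).comp hlim
  have h3 : L = h L := by
    refine tendsto_nhds_unique h1 (h2.congr fun n => ?_)
    simp [pow_succ', Equiv.Perm.mul_apply]
  exact absurd h3 (hlt L ⟨hpL, hLq.trans_lt hq⟩).ne

/-- The first point to the right of `α` where a map that decreases near `α` stops decreasing. -/
lemma exists_first_fixed (hx : x ∈ plGroupOn Λ A α β) (hαβ : α < β) {q : ℝ} (hq : α < q)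
    (hxq : ∀ u ∈ Ioo α q, x u < u) :
    ∃ γ, q ≤ γ ∧ x γ = γ ∧ (∀ u ∈ Ioo α γ, x u < u) ∧
      ∀ y ∈ plGroupOn Λ A α β, Commute x y → y γ = γ := by
  have hcont := continuous_of_strictMono_perm (strictMono_of_mem hx)
  set N := {t | α < t ∧ t ≤ x t} with hN
  have hNne : N.Nonempty := ⟨β, hαβ, (apply_right_endpoint hx).ge⟩
  have hqN : ∀ t ∈ N, q ≤ t := fun t ht => by
    by_contra! h
    exact (hxq t ⟨ht.1, h⟩).not_ge ht.2
  have hbdd : BddBelow N := ⟨q, hqN⟩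
  have hclosed : IsClosed N := by
    have : N = Ici q ∩ {t | t ≤ x t} := by
      ext t
      exact ⟨fun h => ⟨hqN t h, h.2⟩, fun h => ⟨hq.trans_le h.1, h.2⟩⟩
    rw [this]
    exact isClosed_Ici.inter (isClosed_le continuous_id hcont)
  set γ := sInf N with hγ
  have hγN : γ ∈ N := hclosed.csInf_mem hNne hbdd
  have hdecr : ∀ u ∈ Ioo α γ, x u < u := fun u hu => by
    by_contra! h
    exact notMem_of_lt_csInf hu.2 hbdd ⟨hu.1, h⟩
  have hle : ∀ y ∈ plGroupOn Λ A α β, Commute x y → γ ≤ y γ := by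
    intro y hy hxy
    have hm := strictMono_of_mem hy
    refine csInf_le hbdd ⟨?_, ?_⟩
    · have := hm hγN.1
      rwa [apply_left_endpoint hy] at this
    · rw [apply_comm hxy]
      exact hm.monotone hγN.2
  refine ⟨γ, hqN γ hγN, le_antisymm ?_ hγN.2, hdecr, fun y hy hxy => le_antisymm ?_ (hle y hy hxy)⟩
  · have h1 : Ioo α γ ⊆ {t | x t ≤ t} := fun t ht => (hdecr t ht).le
    have h2 : closure (Ioo α γ) ⊆ {t | x t ≤ t} :=
      closure_minimal h1 (isClosed_le hcont continuous_id)
    rw [closure_Ioo hγN.1.ne] at h2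
    exact h2 ⟨hγN.1.le, le_rfl⟩
  · have h1 := hle y⁻¹ (inv_mem hy) hxy.inv_right
    have h2 := (strictMono_of_mem hy).monotone h1
    simpa using h2

/-- If `x` contracts near `α`, the slopes at `α` of the centralizer of `x` are isolated from `1`. -/
lemma slopes_isolated_of_lt_one (hαβ : α < β) {k : PosReal} (hxk : (x, k) ∈ slopeGraph Λ A α β x)
    (hk1 : (k : ℝ) < 1) :
    ∃ η : ℝ, 1 < η ∧ ∀ y m, (y, m) ∈ slopeGraph Λ A α β x → (m : ℝ) ∉ Ioo 1 η := by
  obtain ⟨hx, -, hxα⟩ := hxk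
  simp only at hx hxα
  have hk0 : (0 : ℝ) < k := k.2
  have hxm := strictMono_of_mem hx
  obtain ⟨q, hq, hxq⟩ := mem_nhdsGT_iff_exists_Ioo_subset.1 hxα
  rw [mem_Ioi] at hq
  obtain ⟨γ, hqγ, hxγ, hdecr, hyγ⟩ := exists_first_fixed hx hαβ hq fun u hu => by
    have h1 : x u = α + k * (u - α) := hxq hu
    rw [h1]
    nlinarith [hu.1]
  obtain ⟨e, he, heq⟩ : ∃ e > 0, α + e < q := ⟨(q - α) / 2, by linarith, by linarith⟩
  have hxe : ∀ t ∈ Ioc 0 e, x (α + t) = α + k * t := fun t ht => by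
    have h1 : x (α + t) = α + k * (α + t - α) := hxq ⟨by linarith [ht.1], by linarith [ht.2]⟩
    rw [h1]
    ring
  have hxi := strictMono_inv hxm
  have hincr : ∀ u ∈ Ioo α γ, u < x⁻¹ u := fun u hu => by
    rw [← hxm.lt_iff_lt]
    simpa using hdecr u hu
  have hxiγ : x⁻¹ γ = γ := by rw [Equiv.Perm.inv_eq_iff_eq, hxγ]
  have hiter : ∀ p ∈ Ioo α γ, ∀ q < γ, ∃ n : ℕ, q < (x⁻¹ ^ n) p := fun p hp q hq =>
    exists_lt_pow_apply hxi hp.2 hxiγ (fun u hu => hincr u ⟨hp.1.trans_le hu.1, hu.2⟩) hq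
  obtain ⟨d', hd', σ, -, hσd'⟩ := exists_left_affine hx.1 γ
  rw [hxγ] at hσd'
  obtain ⟨d, hd, hdγ, hσd⟩ : ∃ d > α, d < γ ∧ ∀ u ∈ Icc d γ, x u = γ + σ * (u - γ) :=
    ⟨max d' (α + e), lt_max_of_lt_right (by linarith), max_lt hd' (by linarith),
      fun u hu => hσd' u ⟨(le_max_left _ _).trans hu.1, hu.2⟩⟩
  have hσ1 : (1 : ℝ) < σ := by
    have h1 := hdecr d ⟨hd, hdγ⟩
    rw [hσd d ⟨le_rfl, hdγ.le⟩] at h1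
    by_contra! h
    nlinarith
  have hσ0 : (0 : ℝ) < σ := σ.2
  obtain ⟨n, hn⟩ := hiter (α + k ^ 2 * e) ⟨by nlinarith [pow_pos hk0 2], by
    nlinarith [pow_le_one₀ hk0.le hk1.le (n := 2)]⟩ d hdγ
  set f := x⁻¹ ^ n with hf
  have hfmem : f ∈ plGroupOn Λ A α β := pow_mem (inv_mem hx) n
  have hfm := strictMono_of_mem hfmem
  have hxf : Commute x f := ((Commute.refl x).inv_right).pow_right n
  have hfγ : f γ = γ := hyγ f hfmem hxf
  set W := Ioo (α + k ^ 2 * e) (α + e) with hW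
  have hfW : ∀ u ∈ W, f u ∈ Ioo d γ := fun u hu =>
    ⟨hn.trans (hfm hu.1), hfγ ▸ hfm (by linarith [hu.2])⟩
  have hWpos : ∀ u ∈ W, 0 < u - α := fun u hu => by
    have := hu.1
    have := mul_pos (pow_pos hk0 2) he
    linarith
  obtain ⟨-, -, B, hB, -, hBl⟩ := hfmem.1
  have hev : ∀ᶠ m in 𝓝[>] (1 : ℝ), ∀ b ∈ B ∩ W, α + m * (b - α) < α + e ∧ α + m * (b - α) ∉ B := by
    refine (eventually_all_finite (hB.inter_of_left W)).2 fun b hb => ?_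
    have htend : Tendsto (fun m : ℝ => α + m * (b - α)) (𝓝[>] 1) (𝓝 b) := by
      have h1 : Continuous fun m : ℝ => α + m * (b - α) := by fun_prop
      have h2 := h1.tendsto 1
      rw [one_mul, add_sub_cancel] at h2
      exact h2.mono_left nhdsWithin_le_nhds
    have h3 : (B \ {b})ᶜ ∈ 𝓝 b :=
      (hB.subset sdiff_subset).isClosed.isOpen_compl.mem_nhds (by simp)
    filter_upwards [htend.eventually (gt_mem_nhds hb.2.2), htend.eventually h3,
      self_mem_nhdsWithin] with m h4 h5 h6
    refine ⟨h4, fun h7 => h5 ⟨h7, fun h8 => ?_⟩⟩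
    rw [mem_singleton_iff] at h8
    nlinarith [hWpos b hb.2, mem_Ioi.1 h6]
  obtain ⟨η, hη, hηsub⟩ := mem_nhdsGT_iff_exists_Ioo_subset.1 hev
  refine ⟨η, hη, ?_⟩
  rintro y m ⟨hy, hxy, hyα⟩ hm
  simp only at hy hxy hyα
  have hm0 : (0 : ℝ) < m := m.2
  have hm1 : (1 : ℝ) < m := hm.1
  have hgood : ∀ b ∈ B ∩ W, α + (m : ℝ) * (b - α) < α + e ∧ α + (m : ℝ) * (b - α) ∉ B := hηsub hm
  have hym := strictMono_of_mem hy
  obtain ⟨q₁, hq₁, hyq⟩ := mem_nhdsGT_iff_exists_Ioo_subset.1 hyα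
  rw [mem_Ioi] at hq₁
  have hyq' : ∀ u ∈ Ioo α q₁, y u = α + m * (u - α) := fun u hu => hyq hu
  -- `y` is linear near `α`, uniformly in `y`
  have hylin : ∀ t ∈ Ioc 0 e, (m : ℝ) * t ∈ Ioc 0 e → y (α + t) = α + m * t := fun t ht hmt =>
    linear_of_linear_near hxy (T := Ioc 0 e) hk0 hk1
      (fun t ht => ⟨mul_pos hk0 ht.1, by nlinarith [ht.1, ht.2]⟩) hxe (sub_pos.2 hq₁)
      (fun t ht h => by
        rw [abs_of_pos ht.1] at h
        rw [hyq' _ ⟨by linarith [ht.1], by linarith⟩]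
        ring) ht hmt
  -- `y` is increasing on the whole bump
  have hyincr : ∀ u ∈ Ioo α γ, u < y u := by
    intro u hu
    obtain ⟨q₂, h1, h2⟩ := exists_between (lt_min hq₁ (hq.trans_le hqγ))
    obtain ⟨j, hj⟩ := hiter q₂ ⟨h1, h2.trans_le (min_le_right _ _)⟩ u hu.2
    have hxj : x ^ j ∈ plGroupOn Λ A α β := pow_mem hx j
    have hxjm := strictMono_of_mem hxj
    have h3 : (x ^ j) u < q₂ := by
      have := hxjm hj
      simpa using this
    have h4 : α < (x ^ j) u := by
      have := hxjm hu.1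
      rwa [apply_left_endpoint hxj] at this
    rw [← hxjm.lt_iff_lt, apply_comm (hxy.pow_left j),
      hyq' _ ⟨h4, h3.trans (h2.trans_le (min_le_left _ _))⟩]
    nlinarith
  -- `y` is linear near `γ`, uniformly in `y`
  obtain ⟨d₁, hd₁, ν, -, hνd₁⟩ := exists_left_affine hy.1 γ
  rw [hyγ y hy hxy] at hνd₁
  have hν0 : (0 : ℝ) < ν := ν.2
  have hν1 : (ν : ℝ) < 1 := by
    have h1 := hyincr (max d₁ d) ⟨lt_max_of_lt_right hd, max_lt hd₁ hdγ⟩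
    have h2 : max d₁ d < γ := max_lt hd₁ hdγ
    rw [hνd₁ _ ⟨le_max_left _ _, h2.le⟩] at h1
    by_contra! h
    nlinarith
  have hyγlin : ∀ v ∈ Ioo d γ, y v = γ + ν * (v - γ) := by
    intro v hv
    have hcontr : ∀ c : ℝ, 0 < c → c < 1 → ∀ t ∈ Ico (d - γ) 0, c * t ∈ Ico (d - γ) 0 :=
      fun c hc0 hc1 t ht => ⟨by nlinarith [ht.1, ht.2], by nlinarith [ht.2]⟩
    have hvT : v - γ ∈ Ico (d - γ) 0 := ⟨by linarith [hv.1], by linarith [hv.2]⟩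
    have h1 := linear_of_linear_near (w := x⁻¹) (p := γ) (T := Ico (d - γ) 0) (k := (σ : ℝ)⁻¹)
      (m := ν) hxy.inv_left (inv_pos.2 hσ0) (inv_lt_one_of_one_lt₀ hσ1)
      (hcontr _ (inv_pos.2 hσ0) (inv_lt_one_of_one_lt₀ hσ1))
      (fun t ht => by
        have h2 := hcontr _ (inv_pos.2 hσ0) (inv_lt_one_of_one_lt₀ hσ1) t ht
        rw [Equiv.Perm.inv_eq_iff_eq, hσd _ ⟨by linarith [h2.1], by linarith [h2.2]⟩]
        rw [add_sub_cancel_left, mul_inv_cancel_left₀ hσ0.ne']) (sub_pos.2 hd₁)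
      (fun t ht h => by
        rw [abs_of_neg ht.2] at h
        rw [hνd₁ _ ⟨by linarith, by linarith [ht.2]⟩, add_sub_cancel_left])
      hvT (hcontr _ hν0 hν1 _ hvT)
    rwa [add_sub_cancel] at h1
  -- hence `f` is affine on `W`
  have hlocal : ∀ b ∈ W, ∃ s c : ℝ, ∀ᶠ v in 𝓝 b, f v = s * v + c := by
    intro b hb
    by_cases hbB : b ∈ B
    · obtain ⟨h1, h2⟩ := hgood b ⟨hbB, hb⟩
      obtain ⟨s, -, c, hs⟩ := hBl _ h2
      have hcont : Continuous fun v : ℝ => α + (m : ℝ) * (v - α) := by fun_prop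
      refine ⟨s * m / ν, γ + (s * (α - m * α) + c - γ) / ν, ?_⟩
      filter_upwards [isOpen_Ioo.mem_nhds hb, hcont.continuousAt.eventually hs,
        hcont.continuousAt.eventually (gt_mem_nhds h1)] with v hvW hv1 hv2
      have hv0 := hWpos v hvW
      have h3 := hylin (v - α) ⟨hv0, by linarith [hvW.2]⟩ ⟨mul_pos hm0 hv0, by linarith⟩
      rw [add_sub_cancel] at h3
      have h4 : γ + ν * (f v - γ) = s * (α + m * (v - α)) + c := by
        rw [← hyγlin _ (hfW v hvW), ← hv1, ← h3]
        exact apply_comm ((hxy.inv_left.pow_left n).symm) v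
      field_simp
      linarith
    · obtain ⟨s, -, c, hs⟩ := hBl b hbB
      exact ⟨s, c, hs⟩
  have hke : (k : ℝ) * e < e := by nlinarith
  have hkke : (k : ℝ) ^ 2 * e < k * e := by nlinarith
  have hmid : α + k * e ∈ W := ⟨by linarith, by linarith⟩
  obtain ⟨κ, c, hκ⟩ := hlocal _ hmid
  have hflin := eq_affine_of_locally_affine hmid hκ hlocal
  -- which is incompatible with the slopes of `x` at `α` and `γ`
  have hrel : ∀ t ∈ Ioo (k * e) e, κ * (α + k * t) + c = γ + σ * (κ * (α + t) + c - γ) := by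
    intro t ht
    have hke0 : 0 < k * e := mul_pos hk0 he
    have h1 : α + t ∈ W := ⟨by linarith [ht.1], by linarith [ht.2]⟩
    have h2 : α + k * t ∈ W := ⟨by nlinarith [ht.1], by nlinarith [ht.2]⟩
    rw [← hflin _ h1, ← hflin _ h2, ← hxe t ⟨by linarith [ht.1], ht.2.le⟩,
      ← hσd _ (Ioo_subset_Icc_self (hfW _ h1))]
    exact apply_comm hxf.symm _
  have ht1 : (k * e + e) / 2 ∈ Ioo (k * e) e := ⟨by linarith, by linarith⟩
  have ht2 : (k * e + 3 * e) / 4 ∈ Ioo (k * e) e := ⟨by linarith, by linarith⟩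
  have h1 := hrel _ ht1
  have h2 := hrel _ ht2
  have h3 : κ * ((σ - k) * (e - k * e)) = 0 := by linarith
  have h4 : ((σ : ℝ) - k) * (e - k * e) ≠ 0 := (mul_pos (by linarith) (by linarith)).ne'
  have hκ0 : κ = 0 := (mul_eq_zero.1 h3).resolve_right h4
  have hW1 : α + (k * e + e) / 2 ∈ W := ⟨by linarith [ht1.1], by linarith [ht1.2]⟩
  have h5 : f (α + k * e) = f (α + (k * e + e) / 2) := by
    rw [hflin _ hmid, hflin _ hW1, hκ0]
    ring
  have := f.injective h5
  linarith

lemma slopeGraph_inv : slopeGraph Λ A α β x⁻¹ = slopeGraph Λ A α β x := by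
  ext p
  have : Commute x⁻¹ p.1 ↔ Commute x p.1 := Commute.inv_left_iff
  exact and_congr_right fun _ => and_congr_left fun _ => this

lemma slopes_isolated (hαβ : α < β) {k : PosReal} (hxk : (x, k) ∈ slopeGraph Λ A α β x)
    (hk1 : k ≠ 1) :
    ∃ η : ℝ, 1 < η ∧ ∀ y m, (y, m) ∈ slopeGraph Λ A α β x → (m : ℝ) ∉ Ioo 1 η := by
  rcases lt_or_gt_of_ne hk1 with h | h
  · exact slopes_isolated_of_lt_one hαβ hxk h
  · have hxk' : (x⁻¹, k⁻¹) ∈ slopeGraph Λ A α β x⁻¹ := by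
      rw [slopeGraph_inv]
      exact inv_mem hxk
    obtain ⟨η, hη, hiso⟩ := slopes_isolated_of_lt_one hαβ hxk'
      (show k⁻¹ < 1 from inv_lt_one_of_one_lt h)
    rw [slopeGraph_inv] at hiso
    exact ⟨η, hη, hiso⟩

lemma mulArchimedean_posReal : MulArchimedean PosReal where
  arch a b hb := by
    obtain ⟨n, hn⟩ := pow_unbounded_of_one_lt (a : ℝ) (show (1 : ℝ) < b from hb)
    exact ⟨n, Subtype.coe_le_coe.1 (by simpa using hn.le)⟩

/-- `A` meets every nonempty open interval with endpoints in `A`. -/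
lemma exists_mem_Ioo_of_ne_bot (hΛ : Λ ≠ ⊥)
    (hΛA : ∀ s : PosReal, s ∈ Λ → ∀ a : ℝ, a ∈ A → (s : ℝ) * a ∈ A)
    (hαA : α ∈ A) (hβA : β ∈ A) (hαβ : α < β) : ∃ a ∈ A, a ∈ Ioo α β := by
  obtain ⟨s, hs, hs1⟩ : ∃ s ∈ Λ, (s : ℝ) < 1 := by
    obtain ⟨s, hs, hs1⟩ := Λ.bot_or_exists_ne_one.resolve_left hΛ
    rcases lt_or_gt_of_ne hs1 with h | h
    · exact ⟨s, hs, h⟩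
    · exact ⟨s⁻¹, inv_mem hs, show s⁻¹ < 1 from inv_lt_one_of_one_lt h⟩
  have hs0 : (0 : ℝ) < s := s.2
  exact ⟨α + s * (β - α), add_mem hαA (hΛA _ hs _ (sub_mem hβA hαA)), by nlinarith, by nlinarith⟩

/-- Let `α, β ∈ [0, r] ∩ A` with `α < β`, and set `I = (α, β)`.  Let
`x ∈ F_I(r, Λ, A)` satisfy `fix(x) ∩ I ∩ A = ∅`.  Then the centralizer of `x` in
`F_I(r, Λ, A)` is a cyclic group (the set of integer powers of a single element). -/
theorem centralizer_in_FI_cyclic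
    (r : ℝ) (hr : 0 < r) (Λ : Subgroup PosReal) (hΛ : Λ ≠ ⊥)
    (A : AddSubgroup ℝ) (hrA : r ∈ A)
    (hΛA : ∀ s : PosReal, s ∈ Λ → ∀ a : ℝ, a ∈ A → (s : ℝ) * a ∈ A)
    (α β : ℝ) (hα : α ∈ Set.Icc (0 : ℝ) r) (hαA : α ∈ A)
    (hβ : β ∈ Set.Icc (0 : ℝ) r) (hβA : β ∈ A) (hαβ : α < β)
    (x : Equiv.Perm ℝ) (hx : MemFOn r Λ A (Set.Ioo α β) x)
    (hfix : fixSet x ∩ Set.Ioo α β ∩ (A : Set ℝ) = ∅) :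
    ∃ g : Equiv.Perm ℝ,
      {y : Equiv.Perm ℝ | MemFOn r Λ A (Set.Ioo α β) y ∧ Commute x y}
        = {y : Equiv.Perm ℝ | ∃ n : ℤ, y = g ^ n} := by
  have hmem : ∀ y, MemFOn r Λ A (Set.Ioo α β) y ↔ y ∈ plGroupOn Λ A α β := fun y =>
    ⟨mem_plGroupOn_of_memFOn hΛA, memFOn_of_mem_plGroupOn hr hrA hα.1 hβ.2⟩
  have hx' := (hmem x).1 hx
  have hfix' : ∀ t ∈ Ioo α β, t ∈ A → x t ≠ t := fun t htI htA h => by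
    have : t ∈ fixSet x ∩ Set.Ioo α β ∩ (A : Set ℝ) := ⟨⟨h, htI⟩, htA⟩
    rwa [hfix] at this
  obtain ⟨k, hk⟩ := exists_mem_slopeGraph hx' (Commute.refl x)
  have hk1 : k ≠ 1 := by
    rintro rfl
    have hx1 := eq_one_of_slope_eq_one hx' hfix' hk
    obtain ⟨a, haA, haI⟩ := exists_mem_Ioo_of_ne_bot hΛ hΛA hαA hβA hαβ
    exact hfix' a haI haA (by rw [hx1]; rfl)
  obtain ⟨η, hη, hiso⟩ := slopes_isolated hαβ hk hk1
  set H : Subgroup PosReal := (slopeGraph Λ A α β x).map (MonoidHom.snd _ _) with hH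
  have hHmem : ∀ s, s ∈ H ↔ ∃ y, (y, s) ∈ slopeGraph Λ A α β x := by simp [hH]
  have hη' : (1 : PosReal) < ⟨η, one_pos.trans hη⟩ := hη
  have := mulArchimedean_posReal
  obtain ⟨b, hb⟩ := Subgroup.cyclic_of_isolated_one (H := H) hη' (Set.disjoint_left.2
    fun s hs hsI => by
      obtain ⟨y, hy⟩ := (hHmem s).1 hs
      exact hiso y s hy hsI)
  obtain ⟨g, hg⟩ := (hHmem b).1 (hb ▸ Subgroup.mem_closure_singleton_self b)
  refine ⟨g, Set.ext fun y => ⟨?_, ?_⟩⟩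
  · rintro ⟨hy, hxy⟩
    obtain ⟨s, hs⟩ := exists_mem_slopeGraph ((hmem y).1 hy) hxy
    have hsH := (hHmem s).2 ⟨y, hs⟩
    rw [hb, Subgroup.mem_closure_singleton] at hsH
    obtain ⟨n, rfl⟩ := hsH
    have h1 := mul_mem hs (inv_mem (zpow_mem hg n))
    have h2 : (y, b ^ n) * ((g, b) ^ n)⁻¹ = (y * (g ^ n)⁻¹, 1) := by
      ext1 <;> simp
    rw [h2] at h1
    exact ⟨n, mul_inv_eq_one.1 (eq_one_of_slope_eq_one hx' hfix' h1)⟩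
  · rintro ⟨n, rfl⟩
    have h1 := zpow_mem hg n
    exact ⟨(hmem _).2 h1.1, h1.2.1⟩

end ThompsonStein
end
end

section
/- Let a, b ∈ F(r,Λ,A) satisfy a(t) ≥ t and b(t) ≥ t for all t ∈ [0,r), supp(a) = (0, r), and supp(b) = (α₀, α₁), where α₀ ∈ (0, r) ∩ A and α₁ = a(α₀). For k ∈ ℤ let c_k = a^k ∘ b ∘ a^{−k} denote the conjugate of b by a^k (so that supp(c_k) = a^k(supp(b)) = (a^k(α₀), a^{k+1}(α₀))). Then: the supports of the c_k (k ∈ ℤ) are pairwise disjoint; the subgroup N generated by {c_k : k ∈ ℤ} is the internal direct sum of the infinite cyclic subgroups ⟨c_k⟩; N ∩ ⟨a⟩ = {id}; a normalizes N; the subgroup ⟨a, b⟩ generated by a and b equals N ⋊ ⟨a⟩; and consequently ⟨a, b⟩ is isomorphic to the restricted wreath product ℤ ≀ ℤ, i.e. to the semidirect product (⨁_{k∈ℤ} ℤ) ⋊ ℤ in which ℤ acts on the direct sum by shifting indices, via an isomorphism sending b to the standard generator of the index-0 summand of the base and a to the generator (0, 1) of the acting copy of ℤ. -/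
open Set

noncomputable section

noncomputable section

namespace ZWrZ

/-- The base group of the restricted wreath product `ℤ ≀ ℤ`: the direct sum
`⨁_{k ∈ ℤ} ℤ`, written multiplicatively. -/
abbrev WBase : Type := Multiplicative (ℤ →₀ ℤ)

/-- The shift-by-one automorphism of the base group, sending `f` to `k ↦ f (k - 1)`. -/
def shiftOne : MulAut WBase :=
  AddEquiv.toMultiplicative (Finsupp.domCongr (Equiv.addRight (1 : ℤ)))

/-- The action of `ℤ` on the base group by shifting indices: `n` acts as the `n`-th power
of the shift-by-one automorphism. -/
def wreathAction : Multiplicative ℤ →* MulAut WBase :=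
  zpowersHom (MulAut WBase) shiftOne

/-- The restricted wreath product `W = ℤ ≀ ℤ`, realized as the semidirect product
`(⨁_{k∈ℤ} ℤ) ⋊ ℤ` in which `ℤ` acts on the direct sum by shifting indices. -/
abbrev W : Type := WBase ⋊[wreathAction] Multiplicative ℤ

/-- The element `a = (0, 1)` of `W`: the generator of the acting copy of `ℤ`. -/
def aW : W := SemidirectProduct.inr (Multiplicative.ofAdd (1 : ℤ))

/-- The element `b = (e₀, 0)` of `W`: the standard generator of the index-`0` summand of
the base. -/
def bW : W := SemidirectProduct.inl (Multiplicative.ofAdd (Finsupp.single (0 : ℤ) (1 : ℤ)))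

/-- The base subgroup `H = {(h, 0)} ≤ W`. -/
def HW : Subgroup W := (SemidirectProduct.inl : WBase →* W).range

end ZWrZ

namespace ThompsonStein

open ZWrZ

/-- A pairwise commuting family in a group induces a homomorphism from the direct sum of copies
of `ℤ`. -/
theorem exists_finsupp_hom {ι G : Type*} [Group G] (c : ι → G)
    (hc : ∀ i j, Commute (c i) (c j)) :
    ∃ φ : Multiplicative (ι →₀ ℤ) →* G,
      ∀ i n, φ (Multiplicative.ofAdd (Finsupp.single i n)) = c i ^ n := by
  have : IsMulCommutative (Subgroup.closure (Set.range c)) :=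
    Subgroup.isMulCommutative_closure (by
      rintro _ ⟨i, rfl⟩ _ ⟨j, rfl⟩
      exact hc i j)
  let : CommGroup (Subgroup.closure (Set.range c)) := IsMulCommutative.instCommGroup
  let d : ι → Subgroup.closure (Set.range c) := fun i =>
    ⟨c i, Subgroup.subset_closure ⟨i, rfl⟩⟩
  let ψ : (ι →₀ ℤ) →+ Additive (Subgroup.closure (Set.range c)) :=
    Finsupp.liftAddHom fun i => zmultiplesHom _ (Additive.ofMul (d i))
  refine ⟨(Subgroup.subtype _).comp (AddMonoidHom.toMultiplicativeLeft ψ), fun i n => ?_⟩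
  have h : ψ (Finsupp.single i n) = n • Additive.ofMul (d i) := by
    simp [ψ]
  change ((Additive.toMul (ψ (Finsupp.single i n)) : Subgroup.closure (Set.range c)) : G) = _
  rw [h, toMul_zsmul, toMul_ofMul]
  rfl

theorem hom_finsupp_mem {ι G : Type*} [Group G] {H : Subgroup G}
    (φ : Multiplicative (ι →₀ ℤ) →* G)
    (h : ∀ i n, φ (Multiplicative.ofAdd (Finsupp.single i n)) ∈ H) (f : ι →₀ ℤ) :
    φ (Multiplicative.ofAdd f) ∈ H := by
  induction f using Finsupp.induction_linear with
  | zero => simp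
  | add f g hf hg =>
    rw [ofAdd_add, map_mul]
    exact H.mul_mem hf hg
  | single i n => exact h i n

/-- A homomorphism `φ` on the base group sending the standard generators to elements `c k` that
conjugation by `a` shifts extends to the restricted wreath product `ℤ ≀ ℤ`. -/
theorem exists_wreath_hom {G : Type*} [Group G] (a : G) (c : ℤ → G)
    (hac : ∀ k, a * c k * a⁻¹ = c (k + 1)) (φ : WBase →* G)
    (hφ : ∀ i n, φ (Multiplicative.ofAdd (Finsupp.single i n)) = c i ^ n) :
    ∃ Φ : W →* G, ∀ w : W, Φ w = φ w.left * a ^ Multiplicative.toAdd w.right := by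
  have hshift : φ.comp shiftOne.toMonoidHom = (MulAut.conj a).toMonoidHom.comp φ := by
    refine MonoidHom.toAdditiveRight.injective (Finsupp.addHom_ext fun i n => ?_)
    change φ (shiftOne (Multiplicative.ofAdd (Finsupp.single i n))) =
      a * φ (Multiplicative.ofAdd (Finsupp.single i n)) * a⁻¹
    have h : shiftOne (Multiplicative.ofAdd (Finsupp.single i n)) =
        Multiplicative.ofAdd (Finsupp.single (i + 1) n) := by
      change Multiplicative.ofAdd (Finsupp.equivMapDomain _ (Finsupp.single i n)) = _
      rw [Finsupp.equivMapDomain_single]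
      rfl
    rw [h, hφ, hφ, ← hac, conj_zpow]
  have hstep : ∀ f, φ (shiftOne f) = a * φ f * a⁻¹ := fun f => DFunLike.congr_fun hshift f
  have hpow : ∀ (n : ℤ) f, φ ((shiftOne ^ n) f) = a ^ n * φ f * (a ^ n)⁻¹ := by
    intro n
    induction n using Int.induction_on with
    | zero => simp
    | succ n ih =>
      intro f
      rw [zpow_add_one, MulAut.mul_apply, ih, hstep, zpow_add_one]
      group
    | pred n ih =>
      intro f
      have := hstep (shiftOne⁻¹ f)
      rw [MulAut.apply_inv_self] at this
      rw [zpow_sub_one, MulAut.mul_apply, ih, zpow_sub_one, this]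
      group
  refine ⟨SemidirectProduct.lift φ (zpowersHom G a) fun n => ?_, fun w => rfl⟩
  refine MonoidHom.ext fun f => ?_
  exact hpow (Multiplicative.toAdd n) f

theorem strictMono_zpow_apply {f : Equiv.Perm ℝ} (hle : ∀ t, t ≤ f t) {t : ℝ}
    (ht : f t ≠ t) : StrictMono fun n : ℤ => (f ^ n) t := by
  refine strictMono_int_of_lt_succ fun n => lt_of_le_of_ne ?_ ?_
  · rw [add_comm, zpow_add, zpow_one, Equiv.Perm.mul_apply]
    exact hle _
  · intro h
    rw [zpow_add, zpow_one, Equiv.Perm.mul_apply] at h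
    exact ht ((f ^ n).injective h.symm)

theorem MemF.strictMono {r : ℝ} {Λ : Subgroup PosReal} {A : AddSubgroup ℝ} {f : Equiv.Perm ℝ}
    (hf : MemF r Λ A f) : StrictMono f := by
  obtain ⟨hfix, hmono, -⟩ := hf
  have hmaps : ∀ t ∈ Set.Ico 0 r, f t ∈ Set.Ico 0 r := by
    intro t ht
    by_contra h
    exact h ((f.injective (hfix _ h)).symm ▸ ht)
  intro s t hst
  by_cases hs : s ∈ Set.Ico 0 r <;> by_cases ht : t ∈ Set.Ico 0 r
  · exact hmono hs ht hst
  · rw [hfix t ht]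
    have := hmaps s hs
    simp only [Set.mem_Ico, not_and, not_lt] at *
    linarith [ht (by linarith)]
  · rw [hfix s hs]
    have := hmaps t ht
    simp only [Set.mem_Ico, not_and, not_lt] at *
    by_contra h
    linarith [hs (by linarith)]
  · rwa [hfix s hs, hfix t ht]

theorem strictMono_zpow {f : Equiv.Perm ℝ} (hf : StrictMono f) (n : ℤ) :
    StrictMono (f ^ n : Equiv.Perm ℝ) := by
  have hinv : StrictMono (f⁻¹ : Equiv.Perm ℝ) := fun s t h => by
    rw [← hf.lt_iff_lt]
    simpa using h
  induction n using Int.induction_on with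
  | zero => exact strictMono_id
  | succ n ih =>
    rw [zpow_add_one]
    exact ih.comp hf
  | pred n ih =>
    rw [zpow_sub_one]
    exact ih.comp hinv

theorem mem_supp_conj {f g : Equiv.Perm ℝ} {t : ℝ} :
    t ∈ supp (g * f * g⁻¹) ↔ g⁻¹ t ∈ supp f := by
  simp only [supp, Set.mem_ofPred_eq, Equiv.Perm.mul_apply]
  rw [not_iff_not, ← Equiv.Perm.eq_inv_iff_eq]

theorem apply_mem_supp {f : Equiv.Perm ℝ} {t : ℝ} (ht : t ∈ supp f) (n : ℤ) :
    (f ^ n) t ∈ supp f := by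
  intro h
  rw [← Equiv.Perm.mul_apply, ← zpow_one_add, add_comm, zpow_add, zpow_one,
    Equiv.Perm.mul_apply] at h
  exact ht ((f ^ n).injective h)

theorem commute_of_disjoint_supp {f g : Equiv.Perm ℝ} (h : Disjoint (supp f) (supp g)) :
    Commute f g := by
  refine Equiv.Perm.Disjoint.commute fun t => ?_
  by_contra! ht
  exact Set.disjoint_left.mp h ht.1 ht.2

/-- Let `a, b ∈ F(r,Λ,A)` with `a t ≥ t`, `b t ≥ t` on `[0, r)`,
`supp a = (0, r)`, `supp b = (α₀, α₁)` where `α₀ ∈ (0, r) ∩ A` and `α₁ = a α₀`.  With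
`c k = a ^ k * b * (a ^ k)⁻¹` (so that `supp (c k) = a^k (supp b)`):  the supports of the
`c k` are pairwise disjoint; the subgroup `N` generated by the `c k` is the internal direct
sum of the infinite cyclic subgroups `⟨c k⟩`; `N ∩ ⟨a⟩ = {1}`; `a` normalizes `N`;
`⟨a, b⟩ = N ⋊ ⟨a⟩`; and `⟨a, b⟩` is isomorphic to the restricted wreath product `ℤ ≀ ℤ` via
an isomorphism sending `b` to the standard generator of the index-`0` summand of the base
and `a` to the generator of the acting copy of `ℤ`. -/
theorem subgroup_closure_pair_isWreath
    (r : ℝ) (hr : 0 < r) (Λ : Subgroup PosReal) (hΛ : Λ ≠ ⊥)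
    (A : AddSubgroup ℝ) (hrA : r ∈ A)
    (hΛA : ∀ s : PosReal, s ∈ Λ → ∀ a : ℝ, a ∈ A → (s : ℝ) * a ∈ A)
    (a b : Equiv.Perm ℝ) (ha : MemF r Λ A a) (hb : MemF r Λ A b)
    (haid : ∀ t ∈ Set.Ico (0 : ℝ) r, t ≤ a t)
    (hbid : ∀ t ∈ Set.Ico (0 : ℝ) r, t ≤ b t)
    (hasupp : supp a = Set.Ioo 0 r)
    (α₀ : ℝ) (hα₀ : α₀ ∈ Set.Ioo (0 : ℝ) r) (hα₀A : α₀ ∈ A)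
    (hbsupp : supp b = Set.Ioo α₀ (a α₀))
    (c : ℤ → Equiv.Perm ℝ) (hc : ∀ k : ℤ, c k = a ^ k * b * (a ^ k)⁻¹)
    (N : Subgroup (Equiv.Perm ℝ)) (hN : N = Subgroup.closure (Set.range c)) :
    -- pairwise disjoint supports
    (∀ k l : ℤ, k ≠ l → Disjoint (supp (c k)) (supp (c l))) ∧
    -- `N` is the internal direct sum of the infinite cyclic subgroups `⟨c k⟩`
    (∀ k : ℤ, ∀ m : ℤ, c k ^ m = 1 → m = 0) ∧
    (∀ k l : ℤ, k ≠ l → Commute (c k) (c l)) ∧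
    iSupIndep (fun k : ℤ => Subgroup.zpowers (c k)) ∧
    N = (⨆ k : ℤ, Subgroup.zpowers (c k)) ∧
    -- `N ∩ ⟨a⟩ = {1}`
    N ⊓ Subgroup.zpowers a = ⊥ ∧
    -- `a` normalizes `N`
    (∀ x ∈ N, a * x * a⁻¹ ∈ N ∧ a⁻¹ * x * a ∈ N) ∧
    -- `⟨a, b⟩ = N ⋊ ⟨a⟩`
    Subgroup.closure ({a, b} : Set (Equiv.Perm ℝ)) = N ⊔ Subgroup.zpowers a ∧
    -- `⟨a, b⟩ ≅ ℤ ≀ ℤ`, with `b ↦ e₀` and `a ↦ (0, 1)`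
    ∃ e : W ≃* (Subgroup.closure ({a, b} : Set (Equiv.Perm ℝ))),
      ((e bW : Subgroup.closure ({a, b} : Set (Equiv.Perm ℝ))) : Equiv.Perm ℝ) = b ∧
      ((e aW : Subgroup.closure ({a, b} : Set (Equiv.Perm ℝ))) : Equiv.Perm ℝ) = a := by
  have hamono := ha.strictMono
  have hale : ∀ t, t ≤ a t := fun t => by
    by_cases ht : t ∈ Set.Ico 0 r
    exacts [haid t ht, (ha.1 t ht).ge]
  have hble : ∀ t, t ≤ b t := fun t => by
    by_cases ht : t ∈ Set.Ico 0 r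
    exacts [hbid t ht, (hb.1 t ht).ge]
  have haα : a α₀ ≠ α₀ := by
    rw [← hasupp] at hα₀
    exact hα₀
  have hx := strictMono_zpow_apply hale haα
  have hsupp : ∀ k, supp (c k) = Set.Ioo ((a ^ k) α₀) ((a ^ (k + 1)) α₀) := by
    intro k
    ext t
    rw [hc, mem_supp_conj, hbsupp, Set.mem_Ioo, Set.mem_Ioo, zpow_add_one,
      Equiv.Perm.mul_apply, ← (strictMono_zpow hamono k).lt_iff_lt,
      ← (strictMono_zpow hamono k).lt_iff_lt (b := a α₀), Equiv.Perm.coe_inv, Equiv.apply_symm_apply]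
  have hdisj : ∀ k l : ℤ, k ≠ l → Disjoint (supp (c k)) (supp (c l)) := by
    intro k l hkl
    wlog h : k < l generalizing k l
    · exact (this l k hkl.symm (lt_of_le_of_ne (not_lt.mp h) hkl.symm)).symm
    rw [hsupp, hsupp, Set.disjoint_left]
    intro t hk hl
    exact absurd (hk.2.trans_le ((hx.monotone (show k + 1 ≤ l from h)).trans hl.1.le))
      (lt_irrefl t)
  have hcomm : ∀ k l : ℤ, k ≠ l → Commute (c k) (c l) := fun k l h =>
    commute_of_disjoint_supp (hdisj k l h)
  have hbα : ∃ t, b t ≠ t := by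
    obtain ⟨t, ht⟩ := exists_between (lt_of_le_of_ne (hale α₀) haα.symm)
    rw [← Set.mem_Ioo, ← hbsupp] at ht
    exact ⟨t, ht⟩
  obtain ⟨t₀, ht₀⟩ := hbα
  have ht₀k : ∀ k, (a ^ k) t₀ ∈ supp (c k) := fun k => by
    rw [hc, mem_supp_conj, Equiv.Perm.coe_inv, Equiv.symm_apply_apply]
    exact ht₀
  have hfree : ∀ k m : ℤ, (c k ^ m) ((a ^ k) t₀) = (a ^ k) t₀ → m = 0 := by
    intro k m h
    rw [hc, conj_zpow, Equiv.Perm.mul_apply, Equiv.Perm.mul_apply,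
      Equiv.Perm.coe_inv, Equiv.symm_apply_apply] at h
    exact (strictMono_zpow_apply hble ht₀).injective ((a ^ k).injective h)
  have hfixc : ∀ k l : ℤ, k ≠ l →
      Subgroup.zpowers (c l) ≤ fixingSubgroup (Equiv.Perm ℝ) (supp (c k)) := by
    intro k l hkl
    rw [Subgroup.zpowers_le, mem_fixingSubgroup_iff]
    intro t ht
    by_contra h
    exact Set.disjoint_left.mp (hdisj k l hkl) ht h
  have hNsup : N = ⨆ k : ℤ, Subgroup.zpowers (c k) := by
    rw [hN, ← Set.iUnion_singleton_eq_range, Subgroup.closure_iUnion]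
    simp only [Subgroup.zpowers_eq_closure]
  have hcN : ∀ k, c k ∈ N := fun k => hN ▸ Subgroup.subset_closure ⟨k, rfl⟩
  have hNfix : N ≤ fixingSubgroup (Equiv.Perm ℝ) {α₀} := by
    rw [hN, Subgroup.closure_le]
    rintro _ ⟨k, rfl⟩
    rw [SetLike.mem_coe, mem_fixingSubgroup_iff]
    intro t ht
    rw [Set.mem_singleton_iff.mp ht]
    by_contra h
    have h' : α₀ ∈ supp (c k) := h
    rw [hsupp] at h'
    have h1 : k < 0 := hx.lt_iff_lt.mp (show (a ^ k) α₀ < (a ^ (0 : ℤ)) α₀ from h'.1)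
    have h2 : 0 < k + 1 := hx.lt_iff_lt.mp (show (a ^ (0 : ℤ)) α₀ < (a ^ (k + 1)) α₀ from h'.2)
    omega
  have hNa : ∀ n : ℤ, a ^ n ∈ N → n = 0 := by
    intro n hn
    have h : (a ^ n) α₀ = α₀ := (mem_fixingSubgroup_iff _).mp (hNfix hn) α₀ rfl
    exact hx.injective (h.trans (by simp))
  have hac : ∀ k, a * c k * a⁻¹ = c (k + 1) := by
    intro k
    rw [hc, hc, add_comm, zpow_one_add]
    group
  have hac' : ∀ k, a⁻¹ * c k * a = c (k - 1) := by
    intro k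
    rw [← sub_add_cancel k 1, ← hac, add_sub_cancel_right]
    group
  have hnorm : ∀ x ∈ N, a * x * a⁻¹ ∈ N ∧ a⁻¹ * x * a ∈ N := by
    have h1 : N ≤ N.comap (MulAut.conj a).toMonoidHom := by
      conv_lhs => rw [hN]
      rw [Subgroup.closure_le]
      rintro _ ⟨k, rfl⟩
      change a * c k * a⁻¹ ∈ N
      exact hac k ▸ hcN _
    have h2 : N ≤ N.comap (MulAut.conj a⁻¹).toMonoidHom := by
      conv_lhs => rw [hN]
      rw [Subgroup.closure_le]
      rintro _ ⟨k, rfl⟩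
      change a⁻¹ * c k * a⁻¹⁻¹ ∈ N
      rw [inv_inv, hac']
      exact hcN _
    intro x hx
    refine ⟨h1 hx, ?_⟩
    have := h2 hx
    change a⁻¹ * x * a⁻¹⁻¹ ∈ N at this
    rwa [inv_inv] at this
  have hc0 : c 0 = b := by simp [hc]
  have haG : a ∈ Subgroup.closure ({a, b} : Set (Equiv.Perm ℝ)) :=
    Subgroup.subset_closure (by simp)
  have hbG : b ∈ Subgroup.closure ({a, b} : Set (Equiv.Perm ℝ)) :=
    Subgroup.subset_closure (by simp)
  have hNG : N ≤ Subgroup.closure ({a, b} : Set (Equiv.Perm ℝ)) := by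
    rw [hN, Subgroup.closure_le]
    rintro _ ⟨k, rfl⟩
    rw [hc]
    exact mul_mem (mul_mem (zpow_mem haG k) hbG) (inv_mem (zpow_mem haG k))
  refine ⟨hdisj, fun k m h => hfree k m (by rw [h]; rfl), hcomm, ?_, hNsup, ?_, hnorm, ?_, ?_⟩
  · intro k
    rw [Subgroup.disjoint_def]
    rintro _ ⟨m, rfl⟩ h
    have hle : ⨆ l, ⨆ (_ : l ≠ k), Subgroup.zpowers (c l) ≤
        fixingSubgroup (Equiv.Perm ℝ) (supp (c k)) :=
      iSup₂_le fun l hl => hfixc k l hl.symm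
    have := hfree k m ((mem_fixingSubgroup_iff _).mp (hle h) _ (ht₀k k))
    simp [this]
  · rw [eq_bot_iff]
    rintro _ ⟨hx, n, rfl⟩
    simp [hNa n hx]
  · apply le_antisymm
    · rw [Subgroup.closure_le]
      rintro _ (rfl | rfl)
      · exact (le_sup_right : _ ≤ N ⊔ _) (Subgroup.mem_zpowers _)
      · exact (le_sup_left : N ≤ _) (hc0 ▸ hcN 0)
    · exact sup_le hNG (by rwa [Subgroup.zpowers_le])
  · obtain ⟨φ, hφ⟩ := exists_finsupp_hom c fun i j => by
      rcases eq_or_ne i j with rfl | h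
      exacts [Commute.refl _, hcomm i j h]
    have hφN : ∀ f, φ f ∈ N := hom_finsupp_mem φ fun i n => hφ i n ▸ zpow_mem (hcN i) n
    have hφapply : ∀ (f : ℤ →₀ ℤ) (k : ℤ), ∀ t ∈ supp (c k),
        φ (Multiplicative.ofAdd f) t = (c k ^ f k) t := by
      intro f k
      induction f using Finsupp.induction_linear with
      | zero => simp
      | add f g hf hg =>
        intro t ht
        rw [ofAdd_add, map_mul, Equiv.Perm.mul_apply, hg t ht, hf _ (apply_mem_supp ht _),
          Finsupp.add_apply, zpow_add, Equiv.Perm.mul_apply]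
      | single i n =>
        intro t ht
        rw [hφ]
        rcases eq_or_ne i k with rfl | h
        · simp
        · rw [Finsupp.single_eq_of_ne' h, zpow_zero]
          exact (mem_fixingSubgroup_iff _).mp (hfixc k i h.symm ⟨n, rfl⟩) t ht
    obtain ⟨Φ, hΦ⟩ := exists_wreath_hom a c hac φ hφ
    have hinj : Function.Injective Φ := by
      rw [injective_iff_map_eq_one]
      intro w hw
      rw [hΦ] at hw
      have hn : Multiplicative.toAdd w.right = 0 := by
        refine hNa _ ?_
        rw [← inv_eq_of_mul_eq_one_right hw]
        exact inv_mem (hφN _)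
      rw [hn, zpow_zero, mul_one] at hw
      refine SemidirectProduct.ext ?_ hn
      refine Finsupp.ext fun k => hfree k _ ?_
      exact (hφapply _ k _ (ht₀k k)).symm.trans (DFunLike.congr_fun hw _)
    have hΦa : Φ aW = a := by simp [hΦ, aW]
    have hΦb : Φ bW = b := by
      rw [hΦ, ← hc0]
      simp [bW, hφ]
    have hrange : Φ.range = Subgroup.closure ({a, b} : Set (Equiv.Perm ℝ)) := by
      apply le_antisymm
      · rintro _ ⟨w, rfl⟩
        rw [hΦ]
        exact mul_mem (hNG (hφN _)) (zpow_mem haG _)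
      · rw [Subgroup.closure_le]
        rintro _ (rfl | rfl)
        exacts [⟨aW, hΦa⟩, ⟨bW, hΦb⟩]
    exact ⟨(MonoidHom.ofInjective hinj).trans (MulEquiv.subgroupCongr hrange), hΦb, hΦa⟩

end ThompsonStein
end
end
end

section
/- Let H be a subgroup of F(r,Λ,A). Then H is the centralizer in F(r,Λ,A) of a single element of F(r,Λ,A) if and only if there exist an integer n ≥ 1, points α₀, α₁, …, α_n ∈ A with 0 = α₀ < α₁ < ⋯ < α_n = r, and subgroups H₁, …, H_n of F(r,Λ,A) such that: (1) H is the internal direct product of H₁, …, H_n (the H_i pairwise commute, have pairwise trivial intersections of products, and generate H, with the product decomposition unique); (2) for each i = 1, …, n, either H_i = F_{(α_{i−1}, α_i)}(r,Λ,A), or there exists x ∈ F_{(α_{i−1}, α_i)}(r,Λ,A) such that H_i is the centralizer of x in F_{(α_{i−1}, α_i)}(r,Λ,A) and H_i = ⟨x⟩; and (3) for each i = 1, …, n−1, it is not the case that both H_i = F_{(α_{i−1}, α_i)}(r,Λ,A) and H_{i+1} = F_{(α_i, α_{i+1})}(r,Λ,A). -/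
open Set

noncomputable section

namespace ThompsonStein

/-- The underlying set of the subgroup `F_{(a,b)}(r, Λ, A)`. -/
def FOnSet (r : ℝ) (Λ : Subgroup PosReal) (A : AddSubgroup ℝ) (a b : ℝ) :
    Set (Equiv.Perm ℝ) :=
  {y | MemFOn r Λ A (Set.Ioo a b) y}

/-- The underlying set of the centralizer of `x` in `F_{(a,b)}(r, Λ, A)`. -/
def centrOnSet (r : ℝ) (Λ : Subgroup PosReal) (A : AddSubgroup ℝ) (a b : ℝ)
    (x : Equiv.Perm ℝ) : Set (Equiv.Perm ℝ) :=
  {y | MemFOn r Λ A (Set.Ioo a b) y ∧ Commute x y}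

/-- The group `F(r, Λ, A)` viewed through strictly increasing permutations of `ℝ` that are affine
with slope in `Λ` on every interval whose interior avoids a fixed finite subset of `A`. -/
structure IsPL (r : ℝ) (Λ : Subgroup PosReal) (A : AddSubgroup ℝ) (f : Equiv.Perm ℝ) : Prop where
  strictMono : StrictMono f
  apply_eq_of_notMem : ∀ t, t ∉ Ico 0 r → f t = t
  mem_iff : ∀ u, f u ∈ A ↔ u ∈ A
  pieces : ∃ T : Finset ℝ, (∀ t ∈ T, t ∈ A) ∧ ∀ a b, a < b → (∀ t ∈ T, t ∉ Ioo a b) →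
    ∃ s ∈ Λ, ∃ c : ℝ, ∀ u ∈ Icc a b, f u = (s : ℝ) * u + c

section PL

variable {r : ℝ} {Λ : Subgroup PosReal} {A : AddSubgroup ℝ}

theorem IsPL.one : IsPL r Λ A 1 where
  strictMono := strictMono_id
  apply_eq_of_notMem _ _ := rfl
  mem_iff _ := Iff.rfl
  pieces := ⟨∅, by simp, fun a b _ _ => ⟨1, one_mem _, 0, by simp⟩⟩

theorem IsPL.mul {f g : Equiv.Perm ℝ} (hf : IsPL r Λ A f) (hg : IsPL r Λ A g) :
    IsPL r Λ A (f * g) where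
  strictMono := hf.strictMono.comp hg.strictMono
  apply_eq_of_notMem t ht := by
    simp [hg.apply_eq_of_notMem t ht, hf.apply_eq_of_notMem t ht]
  mem_iff u := by simp [hf.mem_iff, hg.mem_iff]
  pieces := by
    classical
    obtain ⟨T, hT, hTf⟩ := hf.pieces
    obtain ⟨U, hU, hUg⟩ := hg.pieces
    refine ⟨U ∪ T.image (g⁻¹ : Equiv.Perm ℝ), ?_, ?_⟩
    · intro t ht
      rcases Finset.mem_union.1 ht with h | h
      · exact hU t h
      · obtain ⟨w, hw, rfl⟩ := Finset.mem_image.1 h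
        rw [← hg.mem_iff]
        simpa using hT w hw
    · intro a b hab hav
      obtain ⟨s, hs, c, hc⟩ := hUg a b hab fun t ht => hav t (Finset.mem_union_left _ ht)
      obtain ⟨s', hs', c', hc'⟩ := hTf (g a) (g b) (hg.strictMono hab) fun t ht ⟨h1, h2⟩ => by
        refine hav (g⁻¹ t) (Finset.mem_union_right _ (Finset.mem_image_of_mem _ ht)) ⟨?_, ?_⟩
        · rw [← hg.strictMono.lt_iff_lt]; simpa using h1
        · rw [← hg.strictMono.lt_iff_lt]; simpa using h2
      refine ⟨s' * s, mul_mem hs' hs, s' * c + c', fun u hu => ?_⟩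
      rw [Equiv.Perm.mul_apply, hc' _ ⟨hg.strictMono.monotone hu.1, hg.strictMono.monotone hu.2⟩,
        hc u hu, show ((s' * s : PosReal) : ℝ) = s' * s from rfl]
      ring

theorem IsPL.inv {f : Equiv.Perm ℝ} (hf : IsPL r Λ A f) : IsPL r Λ A f⁻¹ where
  strictMono a b hab := by rw [← hf.strictMono.lt_iff_lt]; simpa using hab
  apply_eq_of_notMem t ht := by
    rw [Equiv.Perm.inv_eq_iff_eq, hf.apply_eq_of_notMem t ht]
  mem_iff u := by rw [← hf.mem_iff]; simp
  pieces := by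
    classical
    obtain ⟨T, hT, hTf⟩ := hf.pieces
    refine ⟨T.image f, ?_, ?_⟩
    · intro t ht
      obtain ⟨w, hw, rfl⟩ := Finset.mem_image.1 ht
      exact (hf.mem_iff w).2 (hT w hw)
    · intro a b hab hav
      have hab' : f⁻¹ a < f⁻¹ b := by rw [← hf.strictMono.lt_iff_lt]; simpa using hab
      obtain ⟨s, hs, c, hc⟩ := hTf _ _ hab' fun t ht ⟨h1, h2⟩ => by
        refine hav (f t) (Finset.mem_image_of_mem _ ht) ⟨?_, ?_⟩
        · simpa using hf.strictMono h1
        · simpa using hf.strictMono h2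
      refine ⟨s⁻¹, inv_mem hs, -((s : ℝ)⁻¹ * c), fun u hu => ?_⟩
      have h := hc (f⁻¹ u) ⟨by rw [← hf.strictMono.le_iff_le]; simpa using hu.1,
        by rw [← hf.strictMono.le_iff_le]; simpa using hu.2⟩
      have hs0 : (s : ℝ) ≠ 0 := s.2.ne'
      have h' : u = s * f⁻¹ u + c := by simpa using h
      have hi : ((s⁻¹ : PosReal) : ℝ) = (s : ℝ)⁻¹ := rfl
      rw [hi]
      field_simp
      linarith

theorem IsPL.continuous {f : Equiv.Perm ℝ} (hf : IsPL r Λ A f) : Continuous f :=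
  hf.strictMono.monotone.continuous_of_surjective f.surjective

theorem IsPL.pow {f : Equiv.Perm ℝ} (hf : IsPL r Λ A f) (n : ℕ) : IsPL r Λ A (f ^ n) := by
  induction n with
  | zero => simpa using IsPL.one
  | succ n ih => rw [pow_succ]; exact ih.mul hf

/-- A finite subset of `[0, r]` containing both endpoints, listed in increasing order. -/
theorem exists_strictMono_enumeration (hr : 0 < r) (P : Finset ℝ) (h0 : 0 ∈ P) (h1 : r ∈ P)
    (hP : ∀ p ∈ P, p ∈ Icc 0 r) :
    ∃ n : ℕ, 1 ≤ n ∧ ∃ t : Fin (n + 1) → ℝ, StrictMono t ∧ t 0 = 0 ∧ t (Fin.last n) = r ∧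
      (∀ i, t i ∈ P) ∧ ∀ p ∈ P, ∀ i : Fin n, p ∉ Ioo (t i.castSucc) (t i.succ) := by
  have hc : 1 < P.card := Finset.one_lt_card.2 ⟨0, h0, r, h1, hr.ne⟩
  obtain ⟨n, hn⟩ : ∃ n, P.card = n + 1 := ⟨P.card - 1, by omega⟩
  refine ⟨n, by omega, P.orderEmbOfFin hn, (P.orderEmbOfFin hn).strictMono, ?_, ?_,
    fun i => P.orderEmbOfFin_mem hn i, ?_⟩
  · apply le_antisymm
    · obtain ⟨i, hi⟩ : (0 : ℝ) ∈ range (P.orderEmbOfFin hn) := by simpa using h0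
      rw [← hi]
      exact (P.orderEmbOfFin hn).monotone (Fin.zero_le i)
    · exact (hP _ (P.orderEmbOfFin_mem hn 0)).1
  · apply le_antisymm
    · exact (hP _ (P.orderEmbOfFin_mem hn _)).2
    · obtain ⟨i, hi⟩ : r ∈ range (P.orderEmbOfFin hn) := by simpa using h1
      rw [← hi]
      exact (P.orderEmbOfFin hn).monotone (Fin.le_last i)
  · rintro p hp i ⟨h1, h2⟩
    obtain ⟨j, rfl⟩ : p ∈ range (P.orderEmbOfFin hn) := by simpa using hp
    rw [OrderEmbedding.lt_iff_lt] at h1 h2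
    simp only [Fin.lt_def, Fin.val_castSucc, Fin.val_succ] at h1 h2
    omega

/-- Every point between the first and the last value of `t` lies between two consecutive
values. -/
theorem exists_mem_Icc_castSucc_succ {n : ℕ} (t : Fin (n + 1) → ℝ) {u : ℝ}
    (h0 : t 0 ≤ u) (h1 : u < t (Fin.last n)) :
    ∃ i : Fin n, t i.castSucc ≤ u ∧ u < t i.succ := by
  by_contra! h
  have : ∀ i : Fin (n + 1), t i ≤ u := by
    intro i
    induction i using Fin.induction with
    | zero => exact h0
    | succ i ih => exact h i ih
  exact absurd h1 (not_lt.2 (this _))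

theorem IsPL.memF (hr : 0 < r) (hrA : r ∈ A) {f : Equiv.Perm ℝ} (hf : IsPL r Λ A f) :
    MemF r Λ A f := by
  classical
  refine ⟨hf.apply_eq_of_notMem, hf.strictMono.strictMonoOn _, hf.continuous.continuousOn, ?_⟩
  obtain ⟨T, hT, hTf⟩ := hf.pieces
  obtain ⟨n, -, t, ht, ht0, ht1, htP, htc⟩ := exists_strictMono_enumeration hr
    ((insert 0 (insert r T)).filter fun t => t ∈ Icc 0 r) (by simp [hr.le]) (by simp [hr.le])
    (fun p hp => (Finset.mem_filter.1 hp).2)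
  have htA : ∀ i, t i ∈ A := by
    intro i
    have := (Finset.mem_filter.1 (htP i)).1
    rw [Finset.mem_insert, Finset.mem_insert] at this
    rcases this with h | h | h
    · rw [h]; exact zero_mem _
    · rw [h]; exact hrA
    · exact hT _ h
  refine ⟨n, t, ht, ht0, ht1, htA, fun i => (hf.mem_iff _).2 (htA i), fun i => ?_⟩
  obtain ⟨s, hs, c, hc⟩ := hTf (t i.castSucc) (t i.succ) (ht Fin.castSucc_lt_succ)
    fun p hp hpi => by
      refine htc p ?_ i hpi
      have := ht.monotone (Fin.zero_le i.castSucc)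
      have := ht.monotone (Fin.le_last i.succ)
      refine Finset.mem_filter.2 ⟨by simp [hp], ?_, ?_⟩
      · linarith [hpi.1]
      · linarith [hpi.2]
  exact ⟨s, hs, c, hc⟩

theorem MemF.isPL (hr : 0 < r)
    (hΛA : ∀ s : PosReal, s ∈ Λ → ∀ a : ℝ, a ∈ A → (s : ℝ) * a ∈ A)
    {f : Equiv.Perm ℝ} (hf : MemF r Λ A f) : IsPL r Λ A f := by
  classical
  obtain ⟨hout, hmono, -, n, t, ht, ht0, ht1, htA, hftA, haff⟩ := hf
  have hmaps : ∀ u, f u ∈ Ico 0 r ↔ u ∈ Ico 0 r := by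
    intro u
    by_cases hu : u ∈ Ico 0 r
    · refine iff_of_true ?_ hu
      by_contra hfu
      have := f.injective (hout _ hfu)
      rw [this] at hfu
      exact hfu hu
    · rw [hout u hu]
  have hf0 : f 0 = 0 := by
    have h0 : (0 : ℝ) ∈ Ico 0 r := ⟨le_rfl, hr⟩
    have hw : f⁻¹ 0 ∈ Ico 0 r := by rw [← hmaps]; simpa using hr
    have h := hmono.monotoneOn h0 hw hw.1
    have h' : f (f⁻¹ 0) = 0 := by simp
    rw [h'] at h
    exact le_antisymm h ((hmaps 0).2 h0).1
  have hloc : ∀ u ∈ Ico 0 r, ∃ i : Fin n, t i.castSucc ≤ u ∧ u < t i.succ := fun u hu =>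
    exists_mem_Icc_castSucc_succ t (by rw [ht0]; exact hu.1) (by rw [ht1]; exact hu.2)
  refine ⟨?_, hout, ?_, Finset.univ.image t, ?_, ?_⟩
  · intro a b hab
    by_cases ha : a ∈ Ico 0 r
    · by_cases hb : b ∈ Ico 0 r
      · exact hmono ha hb hab
      · rw [hout b hb]
        refine ((hmaps a).2 ha).2.trans_le ?_
        by_contra! h
        exact hb ⟨by linarith [ha.1], h⟩
    · rw [hout a ha]
      by_cases hb : b ∈ Ico 0 r
      · refine lt_of_lt_of_le ?_ ((hmaps b).2 hb).1
        by_contra! h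
        exact ha ⟨h, by linarith [hb.2]⟩
      · rwa [hout b hb]
  · intro u
    by_cases hu : u ∈ Ico 0 r
    · obtain ⟨i, h1, h2⟩ := hloc u hu
      obtain ⟨s, hs, c, hc⟩ := haff i
      have e1 := hc u ⟨h1, h2.le⟩
      have e2 := hc _ ⟨le_rfl, h1.trans h2.le⟩
      have e3 : f u = s * (u - t i.castSucc) + f (t i.castSucc) := by rw [e1, e2]; ring
      constructor
      · intro h
        have h4 := hΛA s⁻¹ (inv_mem hs) _ (sub_mem h (hftA i.castSucc))
        have hi : ((s⁻¹ : PosReal) : ℝ) = (s : ℝ)⁻¹ := rfl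
        have hs0 : (s : ℝ) ≠ 0 := s.2.ne'
        rw [e3, hi, add_sub_cancel_right, inv_mul_cancel_left₀ hs0] at h4
        simpa using add_mem h4 (htA i.castSucc)
      · intro h
        rw [e3]
        exact add_mem (hΛA s hs _ (sub_mem h (htA _))) (hftA _)
    · rw [hout u hu]
  · simpa using htA
  · intro a b hab hav
    have hav' : ∀ i, t i ∉ Ioo a b := fun i => hav _ (by simp)
    by_cases hb : b ≤ 0
    · refine ⟨1, one_mem _, 0, fun u hu => ?_⟩
      rcases (hu.2.trans hb).lt_or_eq with h | h
      · rw [hout u fun h' => absurd h'.1 (not_le.2 h)]; simp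
      · rw [h, hf0]; simp
    by_cases ha : r ≤ a
    · refine ⟨1, one_mem _, 0, fun u hu => ?_⟩
      rw [hout u fun h' => absurd h'.2 (not_lt.2 (ha.trans hu.1))]; simp
    push Not at ha hb
    have ha0 : 0 ≤ a := by
      by_contra! h
      exact hav' 0 (by rw [ht0]; exact ⟨h, hb⟩)
    obtain ⟨i, h1, h2⟩ := hloc a ⟨ha0, ha⟩
    have hbi : b ≤ t i.succ := by
      by_contra! h
      exact hav' _ ⟨h2, h⟩
    obtain ⟨s, hs, c, hc⟩ := haff i
    exact ⟨s, hs, c, fun u hu => hc u ⟨h1.trans hu.1, hu.2.trans hbi⟩⟩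

theorem IsPL.exists_gap {f : Equiv.Perm ℝ} (hf : IsPL r Λ A f) (γ : ℝ) : ∃ ε > (0 : ℝ),
    ∀ a b, a < b → γ - ε ≤ a → b ≤ γ + ε → (γ ∈ A → γ ∉ Ioo a b) →
      ∃ s ∈ Λ, ∃ c : ℝ, ∀ u ∈ Icc a b, f u = (s : ℝ) * u + c := by
  classical
  obtain ⟨T, hT, hTf⟩ := hf.pieces
  have hc : ((T.erase γ : Finset ℝ) : Set ℝ)ᶜ ∈ nhds γ :=
    (T.erase γ).finite_toSet.isClosed.isOpen_compl.mem_nhds (by simp)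
  obtain ⟨ε, hε, hball⟩ := Metric.mem_nhds_iff.1 hc
  refine ⟨ε, hε, fun a b hab ha hb hγ => hTf a b hab fun t ht hti => ?_⟩
  by_cases h : t = γ
  · subst h
    exact hγ (hT t ht) hti
  · refine hball (a := t) ?_ (by simpa using ⟨ht, h⟩)
    rw [Metric.mem_ball, Real.dist_eq, abs_lt]
    constructor <;> linarith [hti.1, hti.2]

theorem IsPL.exists_right_slope {f : Equiv.Perm ℝ} (hf : IsPL r Λ A f) (γ : ℝ) :
    ∃ s ∈ Λ, ∃ ε > (0 : ℝ), ∀ t ∈ Icc 0 ε, f (γ + t) = f γ + (s : ℝ) * t := by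
  obtain ⟨ε, hε, h⟩ := hf.exists_gap γ
  obtain ⟨s, hs, c, hc⟩ := h γ (γ + ε) (by linarith) (by linarith) le_rfl (by simp)
  refine ⟨s, hs, ε, hε, fun t ht => ?_⟩
  rw [hc γ ⟨le_rfl, by linarith⟩, hc (γ + t) ⟨by linarith [ht.1], by linarith [ht.2]⟩]
  ring

theorem IsPL.exists_left_slope {f : Equiv.Perm ℝ} (hf : IsPL r Λ A f) (γ : ℝ) :
    ∃ s ∈ Λ, ∃ ε > (0 : ℝ), ∀ t ∈ Icc 0 ε, f (γ - t) = f γ - (s : ℝ) * t := by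
  obtain ⟨ε, hε, h⟩ := hf.exists_gap γ
  obtain ⟨s, hs, c, hc⟩ := h (γ - ε) γ (by linarith) le_rfl (by linarith) (by simp)
  refine ⟨s, hs, ε, hε, fun t ht => ?_⟩
  rw [hc γ ⟨by linarith, le_rfl⟩, hc (γ - t) ⟨by linarith [ht.2], by linarith [ht.1]⟩]
  ring

theorem IsPL.exists_slope_of_notMem {f : Equiv.Perm ℝ} (hf : IsPL r Λ A f) {γ : ℝ}
    (hγ : γ ∉ A) :
    ∃ s ∈ Λ, ∃ ε > (0 : ℝ), ∀ t ∈ Icc (-ε) ε, f (γ + t) = f γ + (s : ℝ) * t := by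
  obtain ⟨ε, hε, h⟩ := hf.exists_gap γ
  obtain ⟨s, hs, c, hc⟩ := h (γ - ε) (γ + ε) (by linarith) le_rfl le_rfl fun h => absurd h hγ
  refine ⟨s, hs, ε, hε, fun t ht => ?_⟩
  rw [hc γ ⟨by linarith, by linarith⟩, hc (γ + t) ⟨by linarith [ht.1], by linarith [ht.2]⟩]
  ring

theorem exists_one_lt_mem (hΛ : Λ ≠ ⊥) : ∃ s ∈ Λ, 1 < (s : ℝ) := by
  obtain ⟨s, hs, h1⟩ := (Subgroup.bot_or_exists_ne_one Λ).resolve_left hΛ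
  have hi : ((s⁻¹ : PosReal) : ℝ) = (s : ℝ)⁻¹ := rfl
  rcases lt_trichotomy (s : ℝ) 1 with h | h | h
  · exact ⟨s⁻¹, inv_mem hs, by rw [hi]; exact (one_lt_inv₀ s.2).2 h⟩
  · exact absurd (Subtype.ext h) h1
  · exact ⟨s, hs, h⟩

theorem exists_small_mem (hΛ : Λ ≠ ⊥)
    (hΛA : ∀ s : PosReal, s ∈ Λ → ∀ a : ℝ, a ∈ A → (s : ℝ) * a ∈ A)
    {a : ℝ} (ha : a ∈ A) (ha0 : 0 < a) {ε : ℝ} (hε : 0 < ε) : ∃ d ∈ A, 0 < d ∧ d < ε := by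
  obtain ⟨s, hs, h1⟩ := exists_one_lt_mem hΛ
  obtain ⟨n, hn⟩ := pow_unbounded_of_one_lt (a / ε) h1
  have hi : (((s ^ n)⁻¹ : PosReal) : ℝ) = ((s : ℝ) ^ n)⁻¹ := rfl
  have hp : 0 < (s : ℝ) ^ n := pow_pos s.2 n
  refine ⟨((s ^ n)⁻¹ : PosReal) * a, hΛA _ (inv_mem (pow_mem hs n)) a ha, ?_, ?_⟩
  · rw [hi]; positivity
  · rw [hi, inv_mul_lt_iff₀ hp]
    rwa [div_lt_iff₀ hε] at hn

theorem exists_mem_Ioo (hr : 0 < r) (hΛ : Λ ≠ ⊥) (hrA : r ∈ A)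
    (hΛA : ∀ s : PosReal, s ∈ Λ → ∀ a : ℝ, a ∈ A → (s : ℝ) * a ∈ A)
    {p q : ℝ} (hpq : p < q) : ∃ a ∈ A, a ∈ Ioo p q := by
  have hd : Dense (A : Set ℝ) := AddSubgroup.dense_of_not_isolated_zero A fun ε hε => by
    obtain ⟨d, hd, h0, h1⟩ := exists_small_mem hΛ hΛA hrA hr hε
    exact ⟨d, hd, h0, h1⟩
  obtain ⟨a, ha, haA⟩ := hd.exists_between hpq
  exact ⟨a, ha, haA⟩

/-- The map expanding `[a, a + d]` by the factor `s` and contracting `[a + d, a + d + s * d]` by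
the same factor, the identity elsewhere. -/
def bumpFun (a d s u : ℝ) : ℝ :=
  if u ≤ a then u else if u ≤ a + d then a + s * (u - a)
  else if u ≤ a + d + s * d then a + d + s * d - s⁻¹ * (a + d + s * d - u) else u

theorem bumpFun_of_le {a d s u : ℝ} (h : u ≤ a) : bumpFun a d s u = u := by
  simp [bumpFun, h]

theorem bumpFun_left {a d s u : ℝ} (h : u ∈ Icc a (a + d)) : bumpFun a d s u = a + s * (u - a) := by
  by_cases h' : u ≤ a
  · obtain rfl := le_antisymm h' h.1
    simp [bumpFun]
  · simp [bumpFun, h', h.2]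

theorem bumpFun_right {a d s u : ℝ} (hd : 0 < d) (hs : 0 < s)
    (h : u ∈ Icc (a + d) (a + d + s * d)) :
    bumpFun a d s u = a + d + s * d - s⁻¹ * (a + d + s * d - u) := by
  have h1 : ¬ u ≤ a := by linarith [h.1]
  by_cases h' : u ≤ a + d
  · obtain rfl := le_antisymm h' h.1
    simp only [bumpFun, h1, h', if_true, if_false]
    field_simp
    ring
  · simp [bumpFun, h', h1, h.2]

theorem bumpFun_of_ge {a d s u : ℝ} (hd : 0 < d) (hs : 0 < s) (h : a + d + s * d ≤ u) :
    bumpFun a d s u = u := by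
  have hsd : 0 < s * d := by positivity
  rcases h.eq_or_lt with h | h
  · rw [bumpFun_right hd hs ⟨by linarith, h.ge⟩, ← h]; ring
  · have h1 : ¬ u ≤ a := by linarith
    have h2 : ¬ u ≤ a + d := by linarith
    have h3 : ¬ u ≤ a + d + s * d := by linarith
    simp [bumpFun, h1, h2, h3]

theorem bumpFun_strictMono {a d s : ℝ} (hd : 0 < d) (hs : 0 < s) : StrictMono (bumpFun a d s) := by
  have hsd : 0 < s * d := by positivity
  have h1 : StrictMonoOn (bumpFun a d s) (Iic a) := fun u hu v hv h => by
    rwa [bumpFun_of_le hu, bumpFun_of_le hv]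
  have h2 : StrictMonoOn (bumpFun a d s) (Icc a (a + d)) := fun u hu v hv h => by
    rw [bumpFun_left hu, bumpFun_left hv]
    gcongr
  have h3 : StrictMonoOn (bumpFun a d s) (Icc (a + d) (a + d + s * d)) := fun u hu v hv h => by
    rw [bumpFun_right hd hs hu, bumpFun_right hd hs hv]
    gcongr
  have h4 : StrictMonoOn (bumpFun a d s) (Ici (a + d + s * d)) := fun u hu v hv h => by
    rwa [bumpFun_of_ge hd hs hu, bumpFun_of_ge hd hs hv]
  have h12 := h1.union h2 (c := a) isGreatest_Iic (isLeast_Icc (by linarith))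
  rw [Iic_union_Icc_eq_Iic (by linarith)] at h12
  have h123 := h12.union h3 (c := a + d) isGreatest_Iic (isLeast_Icc (by linarith))
  rw [Iic_union_Icc_eq_Iic (by linarith)] at h123
  have := h123.union h4 (c := a + d + s * d) isGreatest_Iic isLeast_Ici
  rwa [Iic_union_Ici, strictMonoOn_univ] at this

theorem bumpFun_surjective {a d s : ℝ} (hd : 0 < d) (hs : 0 < s) :
    Function.Surjective (bumpFun a d s) := by
  intro w
  have hsd : 0 < s * d := by positivity
  by_cases h1 : w ≤ a
  · exact ⟨w, bumpFun_of_le h1⟩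
  push Not at h1
  by_cases h2 : w ≤ a + s * d
  · refine ⟨a + s⁻¹ * (w - a), ?_⟩
    have hle : s⁻¹ * (w - a) ≤ d := by rw [inv_mul_le_iff₀ hs]; linarith
    have hpos : 0 ≤ s⁻¹ * (w - a) := mul_nonneg (by positivity) (by linarith)
    rw [bumpFun_left ⟨by linarith, by linarith⟩]
    field_simp
    ring
  push Not at h2
  by_cases h3 : w ≤ a + d + s * d
  · refine ⟨a + d + s * d - s * (a + d + s * d - w), ?_⟩
    have hle : s * (a + d + s * d - w) ≤ s * d := by gcongr; linarith
    have hpos : 0 ≤ s * (a + d + s * d - w) := mul_nonneg hs.le (by linarith)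
    rw [bumpFun_right hd hs ⟨by linarith, by linarith⟩]
    field_simp
    ring
  · exact ⟨w, bumpFun_of_ge hd hs (by linarith)⟩

theorem mul_mem_iff (hΛA : ∀ s : PosReal, s ∈ Λ → ∀ a : ℝ, a ∈ A → (s : ℝ) * a ∈ A)
    {s : PosReal} (hs : s ∈ Λ) (a : ℝ) : (s : ℝ) * a ∈ A ↔ a ∈ A := by
  refine ⟨fun h => ?_, hΛA s hs a⟩
  have := hΛA s⁻¹ (inv_mem hs) _ h
  have hi : ((s⁻¹ : PosReal) : ℝ) = (s : ℝ)⁻¹ := rfl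
  rwa [hi, inv_mul_cancel_left₀ s.2.ne'] at this

theorem exists_isPL_ne_one (hΛ : Λ ≠ ⊥)
    (hΛA : ∀ s : PosReal, s ∈ Λ → ∀ a : ℝ, a ∈ A → (s : ℝ) * a ∈ A)
    {a b : ℝ} (haA : a ∈ A) (hbA : b ∈ A) (hab : a < b) (ha : 0 ≤ a) (hb : b ≤ r) :
    ∃ f : Equiv.Perm ℝ, IsPL r Λ A f ∧ (∀ t, t ∉ Ioo a b → f t = t) ∧ ∃ t, f t ≠ t := by
  obtain ⟨s, hs, h1⟩ := exists_one_lt_mem hΛ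
  have hs0 : 0 < (s : ℝ) := s.2
  have hi : ((s⁻¹ : PosReal) : ℝ) = (s : ℝ)⁻¹ := rfl
  obtain ⟨d, hdA, hd, hdlt⟩ := exists_small_mem hΛ hΛA (sub_mem hbA haA) (sub_pos.2 hab)
    (ε := (b - a) / (1 + s)) (div_pos (by linarith) (by linarith))
  have hdb : a + d + s * d < b := by
    rw [lt_div_iff₀ (by linarith)] at hdlt; linarith
  have hsd : 0 < s * d := by positivity
  have hsdA := hΛA s hs d hdA
  have hadA := add_mem haA hdA
  have headA := add_mem hadA hsdA
  have hmono := bumpFun_strictMono (a := a) hd hs0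
  have hsub : ∀ e ∈ A, ∀ w, e - w ∈ A ↔ w ∈ A := fun e he w =>
    ⟨fun h => by simpa using sub_mem he h, fun h => sub_mem he h⟩
  have hsub' : ∀ e ∈ A, ∀ w, w - e ∈ A ↔ w ∈ A := fun e he w =>
    ⟨fun h => by simpa using add_mem h he, fun h => sub_mem h he⟩
  have hout : ∀ t, t ∉ Ioo a b → bumpFun a d s t = t := by
    intro t ht
    by_cases h : t ≤ a
    · exact bumpFun_of_le h
    · refine bumpFun_of_ge hd hs0 ?_
      by_contra! h'
      exact ht ⟨not_le.1 h, by linarith⟩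
  refine ⟨Equiv.ofBijective _ ⟨hmono.injective, bumpFun_surjective hd hs0⟩, ⟨hmono, ?_, ?_, ?_⟩,
    hout, a + d, ?_⟩
  · intro t ht
    exact hout t fun h => ht ⟨by linarith [h.1], by linarith [h.2]⟩
  · intro u
    change bumpFun a d s u ∈ A ↔ u ∈ A
    by_cases hu1 : u ≤ a
    · rw [bumpFun_of_le hu1]
    by_cases hu2 : u ≤ a + d
    · rw [bumpFun_left ⟨by linarith, hu2⟩, add_mem_cancel_left haA, mul_mem_iff hΛA hs,
        hsub' a haA]
    by_cases hu3 : u ≤ a + d + s * d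
    · rw [bumpFun_right hd hs0 ⟨by linarith, hu3⟩, ← hi, hsub _ headA,
        mul_mem_iff hΛA (inv_mem hs), hsub _ headA]
    · rw [bumpFun_of_ge hd hs0 (by linarith)]
  · refine ⟨{a, a + d, a + d + s * d}, ?_, ?_⟩
    · intro t ht
      simp only [Finset.mem_insert, Finset.mem_singleton] at ht
      rcases ht with rfl | rfl | rfl <;> assumption
    · intro p q hpq hav
      simp only [Finset.mem_insert, Finset.mem_singleton, forall_eq_or_imp, forall_eq, mem_Ioo,
        not_and, not_lt] at hav
      obtain ⟨h1, h2, h3⟩ := hav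
      change ∃ s' ∈ Λ, ∃ c : ℝ, ∀ u ∈ Icc p q, bumpFun a d s u = (s' : ℝ) * u + c
      by_cases hq1 : q ≤ a
      · exact ⟨1, one_mem _, 0, fun u hu => by rw [bumpFun_of_le (hu.2.trans hq1)]; simp⟩
      have hp1 : a ≤ p := by by_contra! h; exact hq1 (h1 h)
      by_cases hq2 : q ≤ a + d
      · refine ⟨s, hs, a - s * a, fun u hu => ?_⟩
        rw [bumpFun_left ⟨hp1.trans hu.1, hu.2.trans hq2⟩]; ring
      have hp2 : a + d ≤ p := by by_contra! h; exact hq2 (h2 h)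
      by_cases hq3 : q ≤ a + d + s * d
      · refine ⟨s⁻¹, inv_mem hs, a + d + s * d - (s : ℝ)⁻¹ * (a + d + s * d), fun u hu => ?_⟩
        rw [bumpFun_right hd hs0 ⟨hp2.trans hu.1, hu.2.trans hq3⟩, hi]; ring
      have hp3 : a + d + s * d ≤ p := by by_contra! h; exact hq3 (h3 h)
      exact ⟨1, one_mem _, 0, fun u hu => by rw [bumpFun_of_ge hd hs0 (hp3.trans hu.1)]; simp⟩
  · change bumpFun a d s (a + d) ≠ a + d
    rw [bumpFun_left ⟨by linarith, le_rfl⟩]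
    nlinarith

theorem IsPL.mem_Icc_iff {y : Equiv.Perm ℝ} (hy : IsPL r Λ A y) {a b : ℝ} (ha : y a = a)
    (hb : y b = b) (t : ℝ) : y t ∈ Icc a b ↔ t ∈ Icc a b := by
  have h1 := hy.strictMono.le_iff_le (a := a) (b := t)
  have h2 := hy.strictMono.le_iff_le (a := t) (b := b)
  rw [ha] at h1
  rw [hb] at h2
  rw [mem_Icc, mem_Icc, h1, h2]

theorem IsPL.exists_restrict {y : Equiv.Perm ℝ} (hy : IsPL r Λ A y) {a b : ℝ} (hab : a < b)
    (haA : a ∈ A) (hbA : b ∈ A) (ha : y a = a) (hb : y b = b) :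
    ∃ z : Equiv.Perm ℝ, IsPL r Λ A z ∧ (∀ t ∈ Icc a b, z t = y t) ∧
      ∀ t, t ∉ Ioo a b → z t = t := by
  classical
  have hI := hy.mem_Icc_iff ha hb
  obtain ⟨z, hz1, hz2⟩ : ∃ z : Equiv.Perm ℝ, (∀ t ∈ Icc a b, z t = y t) ∧
      ∀ t, t ∉ Icc a b → z t = t := by
    refine ⟨Equiv.Perm.ofSubtype (y.subtypePerm hI), fun t ht => ?_, fun t ht => ?_⟩
    · rw [Equiv.Perm.ofSubtype_apply_of_mem _ ht]; rfl
    · exact Equiv.Perm.ofSubtype_apply_of_not_mem _ ht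
  have hout : ∀ t, t ∉ Ioo a b → z t = t := by
    intro t ht
    by_cases h : t ∈ Icc a b
    · rw [hz1 t h]
      rcases h.1.eq_or_lt with h1 | h1
      · rw [← h1, ha]
      rcases h.2.eq_or_lt with h2 | h2
      · rw [h2, hb]
      exact absurd ⟨h1, h2⟩ ht
    · exact hz2 t h
  refine ⟨z, ⟨?_, ?_, ?_, ?_⟩, hz1, hout⟩
  · intro u v huv
    by_cases hu : u ∈ Icc a b
    · by_cases hv : v ∈ Icc a b
      · rw [hz1 u hu, hz1 v hv]; exact hy.strictMono huv
      · rw [hz1 u hu, hz2 v hv]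
        refine ((hI u).2 hu).2.trans_lt ?_
        by_contra! h
        exact hv ⟨hu.1.trans huv.le, h⟩
    · rw [hz2 u hu]
      by_cases hv : v ∈ Icc a b
      · rw [hz1 v hv]
        refine lt_of_lt_of_le ?_ ((hI v).2 hv).1
        by_contra! h
        exact hu ⟨h, huv.le.trans hv.2⟩
      · rwa [hz2 v hv]
  · intro t ht
    by_cases h : t ∈ Icc a b
    · rw [hz1 t h, hy.apply_eq_of_notMem t ht]
    · exact hz2 t h
  · intro u
    by_cases h : u ∈ Icc a b
    · rw [hz1 u h, hy.mem_iff]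
    · rw [hz2 u h]
  · obtain ⟨T, hT, hTf⟩ := hy.pieces
    refine ⟨insert a (insert b T), ?_, ?_⟩
    · intro t ht
      rw [Finset.mem_insert, Finset.mem_insert] at ht
      rcases ht with rfl | rfl | h
      exacts [haA, hbA, hT t h]
    · intro p q hpq hav
      have hava : a < q → a ≤ p := fun h =>
        not_lt.1 fun h' => hav a (by simp) ⟨h', h⟩
      have havb : b < q → b ≤ p := fun h =>
        not_lt.1 fun h' => hav b (by simp) ⟨h', h⟩
      by_cases h : a ≤ p ∧ q ≤ b
      · obtain ⟨s, hs, c, hc⟩ := hTf p q hpq fun t ht => hav t (by simp [ht])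
        refine ⟨s, hs, c, fun u hu => ?_⟩
        rw [hz1 u ⟨h.1.trans hu.1, hu.2.trans h.2⟩, hc u hu]
      · refine ⟨1, one_mem _, 0, fun u hu => ?_⟩
        rw [hout u]
        · simp
        · intro hu'
          refine h ⟨hava (hu'.1.trans_le hu.2), ?_⟩
          by_contra! h'
          linarith [havb h', hu'.2, hu.1]

/-- The fixed points of `x` near which `x` is not the identity. -/
def fixBoundary (x : Equiv.Perm ℝ) : Set ℝ := {γ | x γ = γ ∧ ¬ ∀ᶠ u in nhds γ, x u = u}

theorem IsPL.fixBoundary_subset {x : Equiv.Perm ℝ} (hx : IsPL r Λ A x) :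
    fixBoundary x ⊆ Icc 0 r := by
  intro γ hγ
  by_contra h
  refine hγ.2 ?_
  filter_upwards [isClosed_Icc.isOpen_compl.mem_nhds h] with u hu
  exact hx.apply_eq_of_notMem u fun h' => hu ⟨h'.1, h'.2.le⟩

theorem IsPL.eventually_notMem_fixBoundary {x : Equiv.Perm ℝ} (hx : IsPL r Λ A x) (γ : ℝ) :
    ∀ᶠ u in nhdsWithin γ {γ}ᶜ, u ∉ fixBoundary x := by
  by_cases hγ : x γ = γ
  · rw [← Iio_union_Ioi, nhdsWithin_union, Filter.eventually_sup]
    constructor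
    · obtain ⟨s, -, ε, hε, h⟩ := hx.exists_left_slope γ
      have hx' : ∀ u ∈ Ioo (γ - ε) γ, x u = γ - s * (γ - u) := fun u hu => by
        have := h (γ - u) ⟨by linarith [hu.2], by linarith [hu.1]⟩
        rwa [sub_sub_cancel, hγ] at this
      filter_upwards [Ioo_mem_nhdsLT (show γ - ε < γ by linarith)] with u hu hB
      by_cases hs : (s : ℝ) = 1
      · refine hB.2 ?_
        filter_upwards [isOpen_Ioo.mem_nhds hu] with v hv
        rw [hx' v hv, hs]; ring
      · have h1 := hB.1
        rw [hx' u hu] at h1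
        have : ((s : ℝ) - 1) * (γ - u) = 0 := by linarith
        rcases mul_eq_zero.1 this with h2 | h2
        · exact hs (by linarith)
        · linarith [hu.2]
    · obtain ⟨s, -, ε, hε, h⟩ := hx.exists_right_slope γ
      have hx' : ∀ u ∈ Ioo γ (γ + ε), x u = γ + s * (u - γ) := fun u hu => by
        have := h (u - γ) ⟨by linarith [hu.1], by linarith [hu.2]⟩
        rwa [add_sub_cancel, hγ] at this
      filter_upwards [Ioo_mem_nhdsGT (show γ < γ + ε by linarith)] with u hu hB
      by_cases hs : (s : ℝ) = 1
      · refine hB.2 ?_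
        filter_upwards [isOpen_Ioo.mem_nhds hu] with v hv
        rw [hx' v hv, hs]; ring
      · have h1 := hB.1
        rw [hx' u hu] at h1
        have : ((s : ℝ) - 1) * (u - γ) = 0 := by linarith
        rcases mul_eq_zero.1 this with h2 | h2
        · exact hs (by linarith)
        · linarith [hu.1]
  · have : ∀ᶠ u in nhds γ, x u ≠ u := (isOpen_ne_fun hx.continuous continuous_id).mem_nhds hγ
    filter_upwards [nhdsWithin_le_nhds this] with u hu hB
    exact hu hB.1

theorem IsPL.finite_fixBoundary {x : Equiv.Perm ℝ} (hx : IsPL r Λ A x) :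
    (fixBoundary x).Finite := by
  by_contra hinf
  obtain ⟨γ, -, hγ⟩ := Set.Infinite.exists_accPt_of_subset_isCompact hinf isCompact_Icc
    hx.fixBoundary_subset
  rw [accPt_iff_frequently] at hγ
  refine hγ ?_
  have := hx.eventually_notMem_fixBoundary γ
  rw [eventually_nhdsWithin_iff] at this
  filter_upwards [this] with u hu h
  exact hu h.1 h.2

theorem commute_apply {x y : Equiv.Perm ℝ} (h : Commute x y) (u : ℝ) : x (y u) = y (x u) :=
  Equiv.congr_fun h u

theorem apply_mem_fixBoundary {x y : Equiv.Perm ℝ} (h : Commute x y) (hyc : Continuous y) {γ : ℝ}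
    (hγ : γ ∈ fixBoundary x) :
    y γ ∈ fixBoundary x := by
  refine ⟨by rw [commute_apply h, hγ.1], fun hev => hγ.2 ?_⟩
  filter_upwards [hyc.continuousAt.eventually hev] with u hu
  rw [commute_apply h] at hu
  exact y.injective hu

theorem apply_eq_of_finite_of_mapsTo {y : ℝ → ℝ} (hy : StrictMono y) {S : Set ℝ}
    (hS : S.Finite) (hm : MapsTo y S S) {γ : ℝ} (hγ : γ ∈ S) : y γ = γ := by
  have hmem : ∀ n : ℕ, y^[n] γ ∈ S := fun n => (hm.iterate n) hγ
  rcases lt_trichotomy (y γ) γ with h | h | h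
  · exact absurd hS (Set.infinite_of_injective_forall_mem
      (hy.strictAnti_iterate_of_map_lt h).injective hmem)
  · exact h
  · exact absurd hS (Set.infinite_of_injective_forall_mem
      (hy.strictMono_iterate_of_lt_map h).injective hmem)

theorem IsPL.apply_eq_of_mem_fixBoundary {x y : Equiv.Perm ℝ} (hx : IsPL r Λ A x)
    (hy : IsPL r Λ A y) (h : Commute x y) {γ : ℝ} (hγ : γ ∈ fixBoundary x) : y γ = γ :=
  apply_eq_of_finite_of_mapsTo hy.strictMono hx.finite_fixBoundary
    (fun _ hu => apply_mem_fixBoundary h hy.continuous hu) hγ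

/-- `y` fixes `α` and is affine with slope `s` on some interval `[α, α + ε]`. -/
def FixesWithRightSlope (α : ℝ) (y : Equiv.Perm ℝ) (s : ℝ) : Prop :=
  ∃ ε > (0 : ℝ), ∀ t ∈ Icc 0 ε, y (α + t) = α + s * t

theorem FixesWithRightSlope.apply_eq {α s : ℝ} {y : Equiv.Perm ℝ}
    (h : FixesWithRightSlope α y s) : y α = α := by
  obtain ⟨ε, hε, h⟩ := h
  simpa using h 0 ⟨le_rfl, hε.le⟩

theorem FixesWithRightSlope.one (α : ℝ) : FixesWithRightSlope α 1 1 :=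
  ⟨1, one_pos, fun t _ => by simp⟩

theorem FixesWithRightSlope.mul {α s s' : ℝ} {y z : Equiv.Perm ℝ} (hs' : 0 < s')
    (hy : FixesWithRightSlope α y s) (hz : FixesWithRightSlope α z s') :
    FixesWithRightSlope α (y * z) (s * s') := by
  obtain ⟨ε, hε, h⟩ := hy
  obtain ⟨ε', hε', h'⟩ := hz
  refine ⟨min ε' (ε / s'), lt_min hε' (by positivity), fun t ht => ?_⟩
  have h1 : s' * t ≤ ε := by
    have := ht.2.trans (min_le_right _ _)
    rw [le_div_iff₀ hs'] at this
    linarith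
  rw [Equiv.Perm.mul_apply, h' t ⟨ht.1, ht.2.trans (min_le_left _ _)⟩,
    h _ ⟨mul_nonneg hs'.le ht.1, h1⟩, mul_assoc]

theorem FixesWithRightSlope.inv {α s : ℝ} {y : Equiv.Perm ℝ} (hs : 0 < s)
    (hy : FixesWithRightSlope α y s) : FixesWithRightSlope α y⁻¹ s⁻¹ := by
  obtain ⟨ε, hε, h⟩ := hy
  refine ⟨s * ε, by positivity, fun t ht => ?_⟩
  rw [Equiv.Perm.inv_eq_iff_eq, h]
  · rw [mul_inv_cancel_left₀ hs.ne']
  · refine ⟨mul_nonneg (by positivity) ht.1, ?_⟩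
    rw [inv_mul_le_iff₀ hs]
    exact ht.2

theorem FixesWithRightSlope.pow {α s : ℝ} {y : Equiv.Perm ℝ} (hs : 0 < s)
    (hy : FixesWithRightSlope α y s) (n : ℕ) : FixesWithRightSlope α (y ^ n) (s ^ n) := by
  induction n with
  | zero => simpa using FixesWithRightSlope.one α
  | succ n ih =>
    rw [pow_succ, pow_succ]
    exact ih.mul hs hy

theorem FixesWithRightSlope.zpow {α s : ℝ} {y : Equiv.Perm ℝ} (hs : 0 < s)
    (hy : FixesWithRightSlope α y s) (k : ℤ) : FixesWithRightSlope α (y ^ k) (s ^ k) := by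
  cases k with
  | ofNat n => simpa using hy.pow hs n
  | negSucc n =>
    rw [zpow_negSucc, zpow_negSucc]
    exact (hy.pow hs (n + 1)).inv (pow_pos hs _)

theorem pow_apply_of_linear {g : Equiv.Perm ℝ} {p σ b ε : ℝ} (hb0 : 0 < b) (hb1 : b < 1)
    (hg : ∀ t ∈ Icc 0 ε, g (p + σ * t) = p + σ * (b * t)) (n : ℕ) :
    ∀ t ∈ Icc 0 ε, (g ^ n) (p + σ * t) = p + σ * (b ^ n * t) := by
  induction n with
  | zero => simp
  | succ n ih =>
    intro t ht
    rw [pow_succ, Equiv.Perm.mul_apply, hg t ht, ih]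
    · ring
    · exact ⟨mul_nonneg hb0.le ht.1, (mul_le_of_le_one_left ht.1 hb1.le).trans ht.2⟩

theorem exists_pow_apply_of_linear {g y : Equiv.Perm ℝ} {p σ b c ε τ : ℝ} (hb0 : 0 < b)
    (hb1 : b < 1) (hg : ∀ t ∈ Icc 0 ε, g (p + σ * t) = p + σ * (b * t)) (hτ : 0 < τ)
    (hy : ∀ t ∈ Icc 0 τ, y (p + σ * t) = p + σ * (c * t)) (hgy : Commute g y) {t : ℝ}
    (ht : t ∈ Icc 0 ε) : ∃ n : ℕ, (g ^ n) (y (p + σ * t)) = p + σ * (c * (b ^ n * t)) := by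
  obtain ⟨n, hn⟩ := exists_pow_lt_of_lt_one
    (show 0 < τ / (t + 1) from div_pos hτ (by linarith [ht.1])) hb1
  refine ⟨n, ?_⟩
  rw [lt_div_iff₀ (by linarith [ht.1])] at hn
  have hbn : 0 < b ^ n := by positivity
  rw [commute_apply (hgy.pow_left n), pow_apply_of_linear hb0 hb1 hg n t ht, hy]
  exact ⟨mul_nonneg hbn.le ht.1, by nlinarith⟩

theorem apply_eq_of_linear {g y : Equiv.Perm ℝ} {p σ b c ε τ : ℝ} (hb0 : 0 < b)
    (hb1 : b < 1) (hg : ∀ t ∈ Icc 0 ε, g (p + σ * t) = p + σ * (b * t)) (hτ : 0 < τ)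
    (hy : ∀ t ∈ Icc 0 τ, y (p + σ * t) = p + σ * (c * t)) (hgy : Commute g y) {t : ℝ}
    (ht : t ∈ Icc 0 ε) (hct : c * t ∈ Icc 0 ε) : y (p + σ * t) = p + σ * (c * t) := by
  obtain ⟨n, hn⟩ := exists_pow_apply_of_linear hb0 hb1 hg hτ hy hgy ht
  refine (g ^ n).injective ?_
  rw [hn, pow_apply_of_linear hb0 hb1 hg n _ hct]
  ring

theorem eq_mul_of_linear {g y : Equiv.Perm ℝ} {p σ b c ε τ : ℝ} (hσ : σ ≠ 0) (hb0 : 0 < b)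
    (hb1 : b < 1) (hg : ∀ t ∈ Icc 0 ε, g (p + σ * t) = p + σ * (b * t)) (hτ : 0 < τ)
    (hy : ∀ t ∈ Icc 0 τ, y (p + σ * t) = p + σ * (c * t)) (hgy : Commute g y) {t w : ℝ}
    (ht : t ∈ Icc 0 ε) (hw : w ∈ Icc 0 ε) (hyw : y (p + σ * t) = p + σ * w) : w = c * t := by
  obtain ⟨n, hn⟩ := exists_pow_apply_of_linear hb0 hb1 hg hτ hy hgy ht
  rw [hyw, pow_apply_of_linear hb0 hb1 hg n w hw] at hn
  have h1 := mul_left_cancel₀ hσ (add_left_cancel hn)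
  have hbn : b ^ n ≠ 0 := by positivity
  refine mul_left_cancel₀ hbn ?_
  rw [h1]
  ring

/-- A point moved to the right by `x` is carried by the powers of `x` up to a fixed point. -/
theorem IsPL.exists_tendsto_pow {x : Equiv.Perm ℝ} (hx : IsPL r Λ A x) {v : ℝ} (hv : v < x v) :
    ∃ δ, x δ = δ ∧ (∀ n : ℕ, (x ^ n) v < δ) ∧ (∀ n : ℕ, (x ^ n) v < (x ^ (n + 1)) v) ∧
      Filter.Tendsto (fun n : ℕ => (x ^ n) v) Filter.atTop (nhds δ) := by
  have hstep : ∀ n : ℕ, (x ^ n) v < (x ^ (n + 1)) v := fun n => by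
    rw [pow_succ, Equiv.Perm.mul_apply]
    exact (hx.pow n).strictMono hv
  have hmono : StrictMono fun n : ℕ => (x ^ n) v := strictMono_nat_of_lt_succ hstep
  have hvr : v < r := by
    by_contra! h
    rw [hx.apply_eq_of_notMem v fun h' => absurd h'.2 (not_lt.2 h)] at hv
    exact lt_irrefl _ hv
  have hbdd : BddAbove (range fun n : ℕ => (x ^ n) v) := by
    refine ⟨r, ?_⟩
    rintro _ ⟨n, rfl⟩
    have := (hx.pow n).strictMono hvr
    rw [(hx.pow n).apply_eq_of_notMem r (by simp)] at this
    exact this.le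
  have hlim := tendsto_atTop_ciSup hmono.monotone hbdd
  refine ⟨_, ?_, fun n => (hstep n).trans_le (le_ciSup hbdd (n + 1)), hstep, hlim⟩
  have h1 := (hx.continuous.tendsto _).comp hlim
  have h2 := hlim.comp (Filter.tendsto_add_atTop_nat 1)
  refine tendsto_nhds_unique h1 (h2.congr fun n => ?_)
  simp [pow_succ']

theorem IsPL.exists_slope_gap {x : Equiv.Perm ℝ} (hx : IsPL r Λ A x) {α a : ℝ} (ha : 1 < a)
    (hxa : FixesWithRightSlope α x a) : ∃ c₀ > (1 : ℝ), ∀ y c, IsPL r Λ A y → Commute x y →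
      FixesWithRightSlope α y c → 1 < c → c < c₀ → False := by
  have ha0 : 0 < a := by linarith
  obtain ⟨ε, hε, hxε⟩ := hxa
  obtain ⟨v, hv⟩ : ∃ v, v = α + ε / 2 := ⟨_, rfl⟩
  have hvx : v < x v := by
    rw [hv, hxε (ε / 2) ⟨by linarith, by linarith⟩]
    nlinarith
  obtain ⟨δ, hδ, hlt, hstep, hlim⟩ := hx.exists_tendsto_pow hvx
  obtain ⟨b', -, ε', hε', hxδ⟩ := hx.exists_left_slope δ
  obtain ⟨b, hb⟩ : ∃ b : ℝ, b = b' := ⟨_, rfl⟩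
  have hb0 : 0 < b := hb ▸ b'.2
  rw [← hb, hδ] at hxδ
  obtain ⟨N, hN⟩ := (hlim.eventually (lt_mem_nhds (show δ - ε' < δ by linarith))).exists
  have hN' := hlt N
  have hb1 : b < 1 := by
    have h1 := hxδ (δ - (x ^ N) v) ⟨by linarith, by linarith⟩
    have h2 := hstep N
    rw [pow_succ', Equiv.Perm.mul_apply] at h2
    rw [sub_sub_cancel] at h1
    nlinarith
  have hXmono := (hx.pow N).strictMono
  obtain ⟨X, hX⟩ : ∃ X, X = x ^ N := ⟨_, rfl⟩
  obtain ⟨q', -, η₀, hη₀, hXv⟩ := (hx.pow N).exists_right_slope v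
  obtain ⟨q, hq⟩ : ∃ q : ℝ, q = q' := ⟨_, rfl⟩
  have hq0 : 0 < q := hq ▸ q'.2
  have hXδ : X δ = δ := by
    rw [hX]
    clear * - hδ
    induction N with
    | zero => rfl
    | succ n ih => rw [pow_succ, Equiv.Perm.mul_apply, hδ, ih]
  rw [← hq, ← hX] at hXv
  rw [← hX] at hN hN' hXmono
  have hvδ : v < δ := by simpa using hlt 0
  obtain ⟨η, hη⟩ : ∃ η, η = min η₀ (min (ε / 2) (δ - v)) := ⟨_, rfl⟩
  have hη0 : 0 < η := hη ▸ lt_min hη₀ (lt_min (by linarith) (by linarith))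
  have hη1 : η ≤ η₀ := hη ▸ min_le_left _ _
  have hη2 : η ≤ ε / 2 := hη ▸ (min_le_right _ _).trans (min_le_left _ _)
  have hη3 : η ≤ δ - v := hη ▸ (min_le_right _ _).trans (min_le_right _ _)
  have hXrange : ∀ t ∈ Icc 0 η, X (v + t) = X v + q * t ∧ δ - X v - q * t ∈ Icc 0 ε' := by
    intro t ht
    have h1 := hXv t ⟨ht.1, ht.2.trans hη1⟩
    refine ⟨h1, ?_, ?_⟩
    · have h2 := hXmono.monotone (show v + t ≤ δ by linarith [ht.2])
      linarith
    · nlinarith [ht.1]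
  refine ⟨1 + η / (ε / 2), by linarith [show 0 < η / (ε / 2) by positivity], ?_⟩
  intro y c hy hxy hyc hc1 hc
  obtain ⟨τ, hτ, hyτ⟩ := hyc
  have hc0 : 0 < c := by linarith
  have hce : c * (ε / 2) < ε / 2 + η := by
    have : c * (ε / 2) < (1 + η / (ε / 2)) * (ε / 2) := by gcongr
    rwa [add_mul, div_mul_cancel₀ _ (by positivity), one_mul] at this
  have hyδ : y δ = δ := by
    refine hx.apply_eq_of_mem_fixBoundary hy hxy ⟨hδ, fun hev => ?_⟩
    obtain ⟨n, hn⟩ := (hlim.eventually hev).exists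
    have := hstep n
    rw [pow_succ', Equiv.Perm.mul_apply, hn] at this
    exact lt_irrefl _ this
  obtain ⟨c'', -, τ', hτ', hyτ'⟩ := hy.exists_left_slope δ
  obtain ⟨c', hc'⟩ : ∃ c' : ℝ, c' = c'' := ⟨_, rfl⟩
  rw [← hc', hyδ] at hyτ'
  have hxinv : ∀ t ∈ Icc 0 ε, x⁻¹ (α + 1 * t) = α + 1 * (a⁻¹ * t) := by
    intro t ht
    have h1 : a⁻¹ ≤ 1 := inv_le_one_of_one_le₀ ha.le
    have h0 : 0 < a⁻¹ := by positivity
    rw [Equiv.Perm.inv_eq_iff_eq, one_mul, one_mul, hxε, mul_inv_cancel_left₀ ha0.ne']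
    exact ⟨mul_nonneg h0.le ht.1, (mul_le_of_le_one_left ht.1 h1).trans ht.2⟩
  have hyv : ∀ t, 0 ≤ t → c * (ε / 2 + t) ≤ ε / 2 + η →
      y (v + t) = v + (c * (ε / 2 + t) - ε / 2) := by
    intro t ht hct
    have ht1 : ε / 2 + t ≤ c * (ε / 2 + t) := by nlinarith
    have := apply_eq_of_linear (σ := 1) (y := y) (τ := τ) (c := c) (inv_pos.2 ha0)
      (inv_lt_one_of_one_lt₀ ha) hxinv hτ (by simpa using hyτ) hxy.inv_left
      (t := ε / 2 + t) ⟨by linarith, by linarith⟩ ⟨by nlinarith, by linarith⟩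
    rw [one_mul, one_mul, ← add_assoc, ← hv] at this
    rw [this, hv]
    ring
  have key : ∀ t, 0 ≤ t → c * (ε / 2 + t) ≤ ε / 2 + η →
      δ - X v - q * (c * (ε / 2 + t) - ε / 2) = c' * (δ - X v - q * t) := by
    intro t ht hct
    have ht1 : ε / 2 + t ≤ c * (ε / 2 + t) := by nlinarith
    have h1 := hXrange t ⟨ht, by linarith⟩
    have h2 := hXrange (c * (ε / 2 + t) - ε / 2) ⟨by linarith, by linarith⟩
    refine eq_mul_of_linear (σ := -1) (g := x) (y := y) (p := δ) (by norm_num) hb0 hb1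
      (fun t ht => ?_) hτ' (fun t ht => ?_) hxy h1.2 h2.2 ?_
    · have := hxδ t ht
      rw [neg_one_mul, neg_one_mul, ← sub_eq_add_neg, ← sub_eq_add_neg, this]
    · have := hyτ' t ht
      rw [neg_one_mul, neg_one_mul, ← sub_eq_add_neg, ← sub_eq_add_neg, this]
    · have hXy : Commute X y := hX ▸ hxy.pow_left N
      have h3 := commute_apply hXy (v + t)
      rw [hyv t ht hct, h2.1, h1.1] at h3
      have e1 : δ + -1 * (δ - X v - q * t) = X v + q * t := by ring
      rw [e1, ← h3]
      ring
  have hk0 := key 0 le_rfl (by linarith)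
  obtain ⟨t₁, ht₁⟩ : ∃ t₁, t₁ = (ε / 2 + η) / c - ε / 2 := ⟨_, rfl⟩
  have ht₁0 : 0 < t₁ := by
    rw [ht₁, sub_pos, lt_div_iff₀ hc0]
    linarith
  have hk1 := key t₁ ht₁0.le (by
    rw [ht₁, add_sub_cancel, mul_div_cancel₀ _ hc0.ne'])
  have hcc : c = c' := by
    have : q * t₁ * (c - c') = 0 := by linarith
    rcases mul_eq_zero.1 this with h | h
    · exact absurd h (by positivity)
    · linarith
  rw [← hcc] at hk0
  nlinarith [mul_pos hq0 hε]

theorem IsPL.exists_slope_gap_of_ne_one {x : Equiv.Perm ℝ} (hx : IsPL r Λ A x) {α a : ℝ}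
    (ha0 : 0 < a) (ha : a ≠ 1) (hxa : FixesWithRightSlope α x a) :
    ∃ c₀ > (1 : ℝ), ∀ y c, IsPL r Λ A y → Commute x y →
      FixesWithRightSlope α y c → 1 < c → c < c₀ → False := by
  rcases lt_or_gt_of_ne ha with h | h
  · obtain ⟨c₀, hc₀, H⟩ := hx.inv.exists_slope_gap ((one_lt_inv₀ ha0).2 h) (hxa.inv ha0)
    exact ⟨c₀, hc₀, fun y c hy hxy => H y c hy hxy.inv_left⟩
  · exact hx.exists_slope_gap h hxa

theorem IsPL.forall_not_eventually {x : Equiv.Perm ℝ} (hx : IsPL r Λ A x) {α β : ℝ}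
    (hB : ∀ γ ∈ Ioo α β, γ ∈ A → γ ∉ fixBoundary x) (hne : ∃ u ∈ Ioo α β, x u ≠ u) :
    ∀ γ ∈ Ioo α β, ¬ ∀ᶠ u in nhds γ, x u = u := by
  intro γ₀ hγ₀ hev
  have hfix : IsClosed {u | x u = u} := isClosed_eq hx.continuous continuous_id
  have hsub : Ioo α β ⊆ interior {u | x u = u} := by
    refine isPreconnected_Ioo.subset_of_closure_inter_subset isOpen_interior
      ⟨γ₀, hγ₀, mem_interior_iff_mem_nhds.2 hev⟩ ?_
    rintro γ ⟨hγ, hγI⟩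
    by_contra hγn
    have hγx : x γ = γ := closure_minimal interior_subset hfix hγ
    have hγA : γ ∉ A := fun h =>
      hB γ hγI h ⟨hγx, fun h' => hγn (mem_interior_iff_mem_nhds.2 h')⟩
    obtain ⟨s, -, ε, hε, h⟩ := hx.exists_slope_of_notMem hγA
    obtain ⟨u, huI, hu⟩ := Metric.mem_closure_iff.1 hγ ε hε
    rw [Real.dist_eq, abs_lt] at hu
    have h1 := h (u - γ) ⟨by linarith, by linarith⟩
    rw [add_sub_cancel, hγx, show x u = u from interior_subset (s := {u | x u = u}) huI] at h1
    have hs : (s : ℝ) = 1 := by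
      have : ((s : ℝ) - 1) * (u - γ) = 0 := by linarith
      rcases mul_eq_zero.1 this with h2 | h2
      · linarith
      · exact absurd (sub_eq_zero.1 h2 ▸ huI) hγn
    refine hγn (mem_interior_iff_mem_nhds.2 ?_)
    filter_upwards [Ioo_mem_nhds (show γ - ε < γ by linarith) (show γ < γ + ε by linarith)]
      with w hw
    have h2 := h (w - γ) ⟨by linarith [hw.1], by linarith [hw.2]⟩
    rw [add_sub_cancel, hγx, hs] at h2
    rw [h2]
    ring
  obtain ⟨u, hu, hux⟩ := hne
  exact hux (interior_subset (s := {u | x u = u}) (hsub hu))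

theorem IsPL.eq_id_of_slope_one {x y : Equiv.Perm ℝ} (hx : IsPL r Λ A x) (hy : IsPL r Λ A y)
    (hxy : Commute x y) {α β : ℝ} (hxα : x α = α) (hfix : ∀ γ ∈ Ioo α β, x γ = γ → γ ∉ A)
    (hslope : FixesWithRightSlope α y 1) : ∀ u ∈ Icc α β, y u = u := by
  have hcl : IsClosed ({t | ∀ u ∈ Icc α t, y u = u} ∩ Icc α β) := by
    rw [← isSeqClosed_iff_isClosed]
    intro w p hw hp
    have hpI := isClosed_Icc.mem_of_tendsto hp (Filter.Eventually.of_forall fun n => (hw n).2)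
    refine ⟨fun u hu => ?_, hpI⟩
    rcases hu.2.eq_or_lt with h | h
    · have hcw : Filter.Tendsto (fun n => y (w n)) Filter.atTop (nhds (y p)) :=
        (hy.continuous.tendsto p).comp hp
      rw [h]
      exact tendsto_nhds_unique hcw
        (hp.congr fun n => ((hw n).1 (w n) ⟨(hw n).2.1, le_rfl⟩).symm)
    · obtain ⟨n, hn⟩ := (hp.eventually (lt_mem_nhds h)).exists
      exact (hw n).1 u ⟨hu.1, hn.le⟩
  have hmain := hcl.Icc_subset_of_forall_mem_nhdsWithin
    (fun u hu => by rw [le_antisymm hu.2 hu.1]; exact hslope.apply_eq) ?_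
  · exact fun u hu => hmain hu u ⟨hu.1, le_rfl⟩
  rintro γ ⟨hγ, hγI⟩
  have hyγ := hγ γ ⟨hγI.1, le_rfl⟩
  suffices h : ∃ ε > 0, ∀ u ∈ Ioo γ (γ + ε), y u = u by
    obtain ⟨ε, hε, h⟩ := h
    filter_upwards [Ioo_mem_nhdsGT (show γ < γ + ε by linarith)] with t ht u hu
    by_cases hu' : u ≤ γ
    · exact hγ u ⟨hu.1, hu'⟩
    · exact h u ⟨not_le.1 hu', hu.2.trans_lt ht.2⟩
  rcases hγI.1.eq_or_lt with hαγ | hαγ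
  · obtain ⟨ε, hε, h⟩ := hslope
    refine ⟨ε, hε, fun u hu => ?_⟩
    have := h (u - α) ⟨by linarith [hu.1], by linarith [hu.2]⟩
    rw [one_mul, add_sub_cancel] at this
    exact this
  have hmove : ∀ z : Equiv.Perm ℝ, IsPL r Λ A z → Commute z y → z α = α → z γ < γ →
      ∃ ε > 0, ∀ u ∈ Ioo γ (γ + ε), y u = u := by
    intro z hz hzy hzα hlt
    obtain ⟨ε, hε, hball⟩ := Metric.eventually_nhds_iff.1
      ((hz.continuous.tendsto γ).eventually (gt_mem_nhds hlt))
    refine ⟨ε, hε, fun u hu => z.injective ?_⟩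
    have h1 : z u < γ := hball (by
      rw [Real.dist_eq, abs_lt]
      constructor <;> linarith [hu.1, hu.2])
    have h2 := hz.strictMono (hαγ.trans hu.1)
    rw [hzα] at h2
    rw [commute_apply hzy, hγ _ ⟨h2.le, h1.le⟩]
  rcases lt_trichotomy (x γ) γ with hlt | heq | hgt
  · exact hmove x hx hxy hxα hlt
  · obtain ⟨s, -, ε, hε, h⟩ := hy.exists_slope_of_notMem (hfix γ ⟨hαγ, hγI.2⟩ heq)
    rw [hyγ] at h
    have hm : 0 < min ε (γ - α) := lt_min hε (by linarith)
    have hm1 := min_le_left ε (γ - α)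
    have hm2 := min_le_right ε (γ - α)
    have h1 := h (-min ε (γ - α)) ⟨by linarith, by linarith⟩
    rw [hγ _ ⟨by linarith, by linarith⟩] at h1
    have hs : (s : ℝ) = 1 := by
      have : ((s : ℝ) - 1) * min ε (γ - α) = 0 := by linarith
      rcases mul_eq_zero.1 this with h2 | h2 <;> linarith
    refine ⟨ε, hε, fun u hu => ?_⟩
    have h2 := h (u - γ) ⟨by linarith [hu.1], by linarith [hu.2]⟩
    rw [add_sub_cancel, hs] at h2
    rw [h2]
    ring
  · refine hmove x⁻¹ hx.inv hxy.inv_left ?_ ?_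
    · rw [Equiv.Perm.inv_eq_iff_eq, hxα]
    · simpa using hx.inv.strictMono hgt

/-- The subgroup `F_{(a, b)}(r, Λ, A)`. -/
def onSubgroup (r : ℝ) (Λ : Subgroup PosReal) (A : AddSubgroup ℝ) (a b : ℝ) :
    Subgroup (Equiv.Perm ℝ) where
  carrier := {y | IsPL r Λ A y ∧ ∀ t, t ∉ Ioo a b → y t = t}
  one_mem' := ⟨IsPL.one, fun _ _ => rfl⟩
  mul_mem' := fun {x y} hx hy => ⟨hx.1.mul hy.1, fun t ht => by
    rw [Equiv.Perm.mul_apply, hy.2 t ht, hx.2 t ht]⟩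
  inv_mem' := fun {x} hx => ⟨hx.1.inv, fun t ht => by
    rw [Equiv.Perm.inv_eq_iff_eq, hx.2 t ht]⟩

theorem mem_onSubgroup {a b : ℝ} {y : Equiv.Perm ℝ} :
    y ∈ onSubgroup r Λ A a b ↔ IsPL r Λ A y ∧ ∀ t, t ∉ Ioo a b → y t = t := Iff.rfl

theorem commute_iff_of_eqOn {x z y : Equiv.Perm ℝ} (hx : IsPL r Λ A x) {a b : ℝ}
    (hxa : x a = a) (hxb : x b = b) (hzx : ∀ t ∈ Icc a b, z t = x t)
    (hz : ∀ t, t ∉ Ioo a b → z t = t) (hy : IsPL r Λ A y) (hya : y a = a) (hyb : y b = b)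
    (hyo : ∀ t, t ∉ Icc a b → y t = t) : Commute x y ↔ Commute z y := by
  have hxI := hx.mem_Icc_iff hxa hxb
  have hyI := hy.mem_Icc_iff hya hyb
  constructor <;> intro h <;> refine Equiv.ext fun u => ?_ <;>
    rw [Equiv.Perm.mul_apply, Equiv.Perm.mul_apply] <;> by_cases hu : u ∈ Icc a b
  · rw [hzx u hu, hzx _ ((hyI u).2 hu), commute_apply h]
  · rw [hyo u hu, hz u fun h' => hu (Ioo_subset_Icc_self h'), hyo u hu]
  · have := commute_apply h u
    rwa [hzx u hu, hzx _ ((hyI u).2 hu)] at this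
  · rw [hyo u hu, hyo _ fun h' => hu ((hxI u).1 h')]

theorem IsPL.exists_centralizer_eq_zpowers {x : Equiv.Perm ℝ} (hx : IsPL r Λ A x) {α β : ℝ}
    (hαβ : α < β) (hαA : α ∈ A) (hβA : β ∈ A) (hxα : x α = α) (hxβ : x β = β)
    (hB : ∀ γ ∈ Ioo α β, γ ∈ A → γ ∉ fixBoundary x) (hne : ∃ u ∈ Ioo α β, x u ≠ u) :
    ∃ z ∈ onSubgroup r Λ A α β,
      (∀ y, y ∈ onSubgroup r Λ A α β ∧ Commute x y ↔ y ∈ Subgroup.zpowers z) ∧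
      (∀ y, y ∈ onSubgroup r Λ A α β ∧ Commute z y ↔ y ∈ Subgroup.zpowers z) := by
  have hev := hx.forall_not_eventually hB hne
  have hfix : ∀ γ ∈ Ioo α β, x γ = γ → γ ∉ A := fun γ hγ h hA =>
    hB γ hγ hA ⟨h, hev γ hγ⟩
  obtain ⟨a, -, ε, hε, hxε⟩ := hx.exists_right_slope α
  rw [hxα] at hxε
  have ha1 : (a : ℝ) ≠ 1 := by
    intro h
    rw [h] at hxε
    have hm : 0 < min ε (β - α) := lt_min hε (by linarith)
    have hm1 := min_le_left ε (β - α)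
    have hm2 := min_le_right ε (β - α)
    refine hev (α + min ε (β - α) / 2) ⟨by linarith, by linarith⟩ ?_
    filter_upwards [Ioo_mem_nhds (show α < α + min ε (β - α) / 2 by linarith)
      (show α + min ε (β - α) / 2 < α + ε by linarith)] with u hu
    have := hxε (u - α) ⟨by linarith [hu.1], by linarith [hu.2]⟩
    rw [add_sub_cancel] at this
    linarith
  obtain ⟨c₀, hc₀, hgap⟩ := hx.exists_slope_gap_of_ne_one a.2 ha1 ⟨ε, hε, hxε⟩
  let L : AddSubgroup ℝ :=
    { carrier := {l | ∃ y, (y ∈ onSubgroup r Λ A α β ∧ Commute x y) ∧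
        FixesWithRightSlope α y (Real.exp l)}
      zero_mem' := ⟨1, ⟨one_mem _, Commute.one_right x⟩, by
        rw [Real.exp_zero]; exact FixesWithRightSlope.one α⟩
      add_mem' := by
        rintro l m ⟨y, hy, hyl⟩ ⟨z, hz, hzm⟩
        refine ⟨y * z, ⟨mul_mem hy.1 hz.1, hy.2.mul_right hz.2⟩, ?_⟩
        rw [Real.exp_add]
        exact hyl.mul (Real.exp_pos m) hzm
      neg_mem' := by
        rintro l ⟨y, hy, hyl⟩
        refine ⟨y⁻¹, ⟨inv_mem hy.1, hy.2.inv_right⟩, ?_⟩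
        rw [Real.exp_neg]
        exact hyl.inv (Real.exp_pos l) }
  obtain ⟨b, hb⟩ := AddSubgroup.cyclic_of_isolated_zero (H := L) (Real.log_pos hc₀) (by
    rw [Set.disjoint_left]
    rintro l ⟨y, hy, hyl⟩ hl
    refine hgap y _ hy.1.1 hy.2 hyl (Real.one_lt_exp_iff.2 hl.1) ?_
    rw [← Real.lt_log_iff_exp_lt (by linarith)]
    exact hl.2)
  have hbL : b ∈ L := by rw [hb]; exact AddSubgroup.mem_closure_singleton_self b
  obtain ⟨z, hz, hzb⟩ := hbL
  have hiff : ∀ y, y ∈ onSubgroup r Λ A α β ∧ Commute x y ↔ y ∈ Subgroup.zpowers z := by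
    intro y
    constructor
    · intro hy
      obtain ⟨s, -, ε', hε', hyε⟩ := hy.1.1.exists_right_slope α
      rw [hy.1.2 α (by simp)] at hyε
      have hs : (s : ℝ) = Real.exp (Real.log s) := (Real.exp_log s.2).symm
      have hsL : Real.log s ∈ L := ⟨y, hy, by rw [← hs]; exact ⟨ε', hε', hyε⟩⟩
      rw [hb, AddSubgroup.mem_closure_singleton] at hsL
      obtain ⟨k, hk⟩ := hsL
      have hzk := hzb.zpow (Real.exp_pos b) k
      have hek : Real.exp b ^ k = s := by
        rw [← Real.exp_log s.2, ← hk, zsmul_eq_mul, mul_comm, Real.exp_mul, Real.rpow_intCast]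
      rw [hek] at hzk
      have hw := FixesWithRightSlope.mul (inv_pos.2 s.2)
        (show FixesWithRightSlope α y s from ⟨ε', hε', hyε⟩) (hzk.inv s.2)
      rw [mul_inv_cancel₀ s.2.ne'] at hw
      have hwm : y * (z ^ k)⁻¹ ∈ onSubgroup r Λ A α β :=
        mul_mem hy.1 (inv_mem (zpow_mem hz.1 k))
      have hid := hx.eq_id_of_slope_one hwm.1
        (hy.2.mul_right (hz.2.zpow_right k).inv_right) hxα hfix hw
      have h1 : y * (z ^ k)⁻¹ = 1 := by
        ext u
        by_cases hu : u ∈ Icc α β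
        · exact hid u hu
        · exact hwm.2 u fun h => hu (Ioo_subset_Icc_self h)
      exact ⟨k, (mul_inv_eq_one.1 h1).symm⟩
    · rintro ⟨k, rfl⟩
      exact ⟨zpow_mem hz.1 k, hz.2.zpow_right k⟩
  refine ⟨z, hz.1, hiff, fun y => ⟨fun hy => ?_, ?_⟩⟩
  · obtain ⟨x', hx', hx'x, hx'o⟩ := hx.exists_restrict hαβ hαA hβA hxα hxβ
    have hcomm : ∀ w ∈ onSubgroup r Λ A α β, Commute x w ↔ Commute x' w := fun w hw =>
      commute_iff_of_eqOn hx hxα hxβ hx'x hx'o hw.1 (hw.2 α (by simp)) (hw.2 β (by simp))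
        fun t ht => hw.2 t fun h => ht (Ioo_subset_Icc_self h)
    obtain ⟨k, hk⟩ := (hiff x').1 ⟨⟨hx', hx'o⟩, (hcomm x' ⟨hx', hx'o⟩).2 (Commute.refl x')⟩
    refine (hiff y).1 ⟨hy.1, (hcomm y hy.1).2 ?_⟩
    rw [← hk]
    exact hy.2.zpow_left k
  · rintro ⟨k, rfl⟩
    exact ⟨zpow_mem hz.1 k, (Commute.refl z).zpow_right k⟩

/-- The group `F(r, Λ, A)`. -/
def plSubgroup (r : ℝ) (Λ : Subgroup PosReal) (A : AddSubgroup ℝ) : Subgroup (Equiv.Perm ℝ) where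
  carrier := {y | IsPL r Λ A y}
  one_mem' := IsPL.one
  mul_mem' := IsPL.mul
  inv_mem' := IsPL.inv

theorem mem_plSubgroup {y : Equiv.Perm ℝ} : y ∈ plSubgroup r Λ A ↔ IsPL r Λ A y := Iff.rfl

theorem memF_iff_isPL (hr : 0 < r) (hrA : r ∈ A)
    (hΛA : ∀ s : PosReal, s ∈ Λ → ∀ a : ℝ, a ∈ A → (s : ℝ) * a ∈ A) (f : Equiv.Perm ℝ) :
    MemF r Λ A f ↔ IsPL r Λ A f :=
  ⟨fun h => h.isPL hr hΛA, fun h => h.memF hr hrA⟩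

theorem memFOn_iff (hr : 0 < r) (hrA : r ∈ A)
    (hΛA : ∀ s : PosReal, s ∈ Λ → ∀ a : ℝ, a ∈ A → (s : ℝ) * a ∈ A) {a b : ℝ}
    (f : Equiv.Perm ℝ) : MemFOn r Λ A (Ioo a b) f ↔ f ∈ onSubgroup r Λ A a b := by
  rw [MemFOn, memF_iff_isPL hr hrA hΛA, mem_onSubgroup]
  refine and_congr_right fun _ => forall_congr' fun t => ?_
  exact not_imp_comm

theorem IsPL.apply_zero {y : Equiv.Perm ℝ} (hy : IsPL r Λ A y) : y 0 = 0 := by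
  have key : ∀ z : Equiv.Perm ℝ, IsPL r Λ A z → 0 ≤ z 0 := by
    intro z hz
    by_contra! h
    have := z.injective (hz.apply_eq_of_notMem (z 0) fun h' => absurd h'.1 (not_le.2 h))
    exact h.ne this
  have h := hy.strictMono.monotone (key _ hy.inv)
  rw [← Equiv.Perm.mul_apply, mul_inv_cancel] at h
  exact le_antisymm h (key y hy)

theorem commute_of_disjoint {x y : Equiv.Perm ℝ} (h : ∀ t, x t = t ∨ y t = t) : Commute x y :=
  Equiv.Perm.Disjoint.commute h

theorem commute_restrict {x y z : Equiv.Perm ℝ} (hx : IsPL r Λ A x) (hxy : Commute x y) {a b : ℝ}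
    (ha : x a = a) (hb : x b = b) (hzy : ∀ t ∈ Icc a b, z t = y t)
    (hz : ∀ t, t ∉ Ioo a b → z t = t) : Commute x z := by
  have hI := hx.mem_Icc_iff ha hb
  refine Equiv.ext fun u => ?_
  rw [Equiv.Perm.mul_apply, Equiv.Perm.mul_apply]
  by_cases hu : u ∈ Icc a b
  · rw [hzy u hu, hzy _ ((hI u).2 hu), commute_apply hxy]
  · rw [hz u fun h => hu (Ioo_subset_Icc_self h),
      hz _ fun h => hu ((hI u).1 (Ioo_subset_Icc_self h))]

theorem prod_ofFn_apply_eq_self {n : ℕ} (t : Fin n → Equiv.Perm ℝ) {u : ℝ}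
    (h : ∀ j, t j u = u) : (List.ofFn t).prod u = u := by
  induction n with
  | zero => simp
  | succ n ih =>
    rw [List.ofFn_succ, List.prod_cons, Equiv.Perm.mul_apply, ih _ fun j => h _, h]

theorem prod_ofFn_apply {n : ℕ} (t : Fin n → Equiv.Perm ℝ) {u : ℝ} (i : Fin n)
    (h1 : ∀ j, j ≠ i → t j u = u) (h2 : ∀ j, j ≠ i → t j (t i u) = t i u) :
    (List.ofFn t).prod u = t i u := by
  induction n with
  | zero => exact i.elim0
  | succ n ih =>
    rw [List.ofFn_succ, List.prod_cons, Equiv.Perm.mul_apply]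
    cases i using Fin.cases with
    | zero => rw [prod_ofFn_apply_eq_self _ fun j => h1 _ (Fin.succ_ne_zero j)]
    | succ i =>
      rw [ih (fun j => t j.succ) i
        (fun j hj => h1 _ (fun h => hj (Fin.succ_injective _ h)))
        (fun j hj => h2 _ (fun h => hj (Fin.succ_injective _ h))),
        h2 0 (Fin.succ_ne_zero i).symm]

theorem notMem_Ioo_of_mem_Icc {n : ℕ} {αs : Fin (n + 1) → ℝ} (hα : StrictMono αs) {i j : Fin n}
    (hij : i ≠ j) {u : ℝ} (hu : u ∈ Icc (αs i.castSucc) (αs i.succ)) :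
    u ∉ Ioo (αs j.castSucc) (αs j.succ) := by
  intro h
  have h1 := hα.lt_iff_lt.1 (hu.1.trans_lt h.2)
  have h2 := hα.lt_iff_lt.1 (h.1.trans_le hu.2)
  rw [Fin.lt_def, Fin.val_castSucc, Fin.val_succ] at h1 h2
  exact hij (Fin.ext (by omega))

theorem commute_of_mem_onSubgroup {n : ℕ} {αs : Fin (n + 1) → ℝ} (hα : StrictMono αs)
    {i j : Fin n} (hij : i ≠ j) {x y : Equiv.Perm ℝ}
    (hx : x ∈ onSubgroup r Λ A (αs i.castSucc) (αs i.succ))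
    (hy : y ∈ onSubgroup r Λ A (αs j.castSucc) (αs j.succ)) : Commute x y := by
  refine commute_of_disjoint fun u => ?_
  by_cases hu : u ∈ Ioo (αs i.castSucc) (αs i.succ)
  · exact Or.inr (hy.2 u (notMem_Ioo_of_mem_Icc hα hij (Ioo_subset_Icc_self hu)))
  · exact Or.inl (hx.2 u hu)

theorem prod_ofFn_apply_of_mem_Icc {n : ℕ} {αs : Fin (n + 1) → ℝ} (hα : StrictMono αs)
    {t : Fin n → Equiv.Perm ℝ}
    (ht : ∀ i, t i ∈ onSubgroup r Λ A (αs i.castSucc) (αs i.succ)) (i : Fin n) {u : ℝ}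
    (hu : u ∈ Icc (αs i.castSucc) (αs i.succ)) : (List.ofFn t).prod u = t i u := by
  refine prod_ofFn_apply t i
    (fun j hj => (ht j).2 _ (notMem_Ioo_of_mem_Icc hα hj.symm hu))
    (fun j hj => (ht j).2 _ (notMem_Ioo_of_mem_Icc hα hj.symm ?_))
  exact ((ht i).1.mem_Icc_iff ((ht i).2 _ (by simp)) ((ht i).2 _ (by simp)) u).2 hu

theorem eq_of_prod_ofFn_eq {n : ℕ} {αs : Fin (n + 1) → ℝ} (hα : StrictMono αs)
    {t t' : Fin n → Equiv.Perm ℝ}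
    (ht : ∀ i, t i ∈ onSubgroup r Λ A (αs i.castSucc) (αs i.succ))
    (ht' : ∀ i, t' i ∈ onSubgroup r Λ A (αs i.castSucc) (αs i.succ))
    (h : (List.ofFn t).prod = (List.ofFn t').prod) : t = t' := by
  funext i
  ext u
  by_cases hu : u ∈ Ioo (αs i.castSucc) (αs i.succ)
  · have hu' := Ioo_subset_Icc_self hu
    rw [← prod_ofFn_apply_of_mem_Icc hα ht i hu', h, prod_ofFn_apply_of_mem_Icc hα ht' i hu']
  · rw [(ht i).2 u hu, (ht' i).2 u hu]

theorem IsPL.exists_prod_ofFn {n : ℕ} {αs : Fin (n + 1) → ℝ} (hα : StrictMono αs)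
    (h0 : αs 0 = 0) (hlast : αs (Fin.last n) = r) (hαA : ∀ i, αs i ∈ A) {y : Equiv.Perm ℝ}
    (hy : IsPL r Λ A y) (hfix : ∀ i, y (αs i) = αs i) :
    ∃ t : Fin n → Equiv.Perm ℝ,
      (∀ i, t i ∈ onSubgroup r Λ A (αs i.castSucc) (αs i.succ)) ∧
      (∀ i, ∀ u ∈ Icc (αs i.castSucc) (αs i.succ), t i u = y u) ∧ y = (List.ofFn t).prod := by
  have hlt : ∀ i : Fin n, αs i.castSucc < αs i.succ := fun i => hα Fin.castSucc_lt_succ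
  choose t ht hty hto using fun i : Fin n => hy.exists_restrict (hlt i) (hαA i.castSucc)
    (hαA i.succ) (hfix i.castSucc) (hfix i.succ)
  have htm : ∀ i, t i ∈ onSubgroup r Λ A (αs i.castSucc) (αs i.succ) :=
    fun i => ⟨ht i, hto i⟩
  refine ⟨t, htm, hty, Equiv.ext fun u => ?_⟩
  by_cases hu : u ∈ Ico 0 r
  · obtain ⟨i, h1, h2⟩ := exists_mem_Icc_castSucc_succ αs (u := u) (by rw [h0]; exact hu.1)
      (by rw [hlast]; exact hu.2)
    rw [prod_ofFn_apply_of_mem_Icc hα htm i ⟨h1, h2.le⟩, hty i u ⟨h1, h2.le⟩]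
  · rw [hy.apply_eq_of_notMem u hu,
      prod_ofFn_apply_eq_self t fun j => (ht j).apply_eq_of_notMem u hu]

theorem exists_apply_ne_of_centralizer_eq_zpowers (hr : 0 < r) (hΛ : Λ ≠ ⊥) (hrA : r ∈ A)
    (hΛA : ∀ s : PosReal, s ∈ Λ → ∀ a : ℝ, a ∈ A → (s : ℝ) * a ∈ A) {a b : ℝ} (ha : 0 ≤ a)
    (hb : b ≤ r) {z : Equiv.Perm ℝ}
    (hz : ∀ y ∈ onSubgroup r Λ A a b, Commute z y → y ∈ Subgroup.zpowers z) {p q : ℝ}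
    (hpq : p < q) (hsub : Ioo p q ⊆ Ioo a b) : ∃ u ∈ Ioo p q, z u ≠ u := by
  by_contra! hid
  obtain ⟨a', ha'A, ha'⟩ := exists_mem_Ioo hr hΛ hrA hΛA hpq
  obtain ⟨b', hb'A, hb'⟩ := exists_mem_Ioo hr hΛ hrA hΛA ha'.2
  have hsub' : Ioo a' b' ⊆ Ioo p q := Ioo_subset_Ioo ha'.1.le hb'.2.le
  obtain ⟨f, hf, hfo, u, hu⟩ := exists_isPL_ne_one (r := r) hΛ hΛA ha'A hb'A hb'.1
    (ha.trans (hsub ha').1.le) ((hsub ⟨ha'.1.trans hb'.1, hb'.2⟩).2.le.trans hb)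
  have huI : u ∈ Ioo p q := by
    by_contra h
    exact hu (hfo u fun h' => h (hsub' h'))
  obtain ⟨k, rfl⟩ := hz f ⟨hf, fun t ht => hfo t fun h => ht (hsub (hsub' h))⟩
    (commute_of_disjoint fun t => by
      by_cases ht : t ∈ Ioo p q
      · exact Or.inl (hid t ht)
      · exact Or.inr (hfo t fun h => ht (hsub' h)))
  exact hu (Equiv.Perm.zpow_apply_eq_self_of_apply_eq_self (hid u huI) k)

theorem not_eventually_of_forall_exists {x : Equiv.Perm ℝ} {a b γ : ℝ} (hab : a < b)
    (hγ : γ ∈ Icc a b)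
    (h : ∀ p q, p < q → Ioo p q ⊆ Ioo a b → ∃ u ∈ Ioo p q, x u ≠ u) :
    ¬ ∀ᶠ u in nhds γ, x u = u := by
  intro hev
  obtain ⟨l, m, hlm, hsub⟩ := mem_nhds_iff_exists_Ioo_subset.1 hev
  have hpq : max a l < min b m :=
    max_lt (lt_min hab (hγ.1.trans_lt hlm.2)) (lt_min (hlm.1.trans_le hγ.2) (hlm.1.trans hlm.2))
  obtain ⟨u, hu, hux⟩ := h _ _ hpq (Ioo_subset_Ioo (le_max_left _ _) (min_le_left _ _))
  exact hux (hsub ⟨(le_max_right _ _).trans_lt hu.1, hu.2.trans_le (min_le_right _ _)⟩)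

theorem apply_eq_of_forall_commute (hr : 0 < r) (hΛ : Λ ≠ ⊥) (hrA : r ∈ A)
    (hΛA : ∀ s : PosReal, s ∈ Λ → ∀ a : ℝ, a ∈ A → (s : ℝ) * a ∈ A) {a b : ℝ} (ha : 0 ≤ a)
    (hb : b ≤ r) {x : Equiv.Perm ℝ} (hx : IsPL r Λ A x)
    (h : ∀ y ∈ onSubgroup r Λ A a b, Commute x y) : ∀ u ∈ Ioo a b, x u = u := by
  intro u hu
  by_contra hne
  have key : ∀ z : Equiv.Perm ℝ, IsPL r Λ A z → (∀ y ∈ onSubgroup r Λ A a b, Commute z y) →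
      ¬ u < z u := by
    intro z hz hzc hlt
    obtain ⟨w, huw, hwu⟩ := exists_between (lt_min hlt hu.2)
    have hwz := hwu.trans_le (min_le_left _ _)
    have hwb := hwu.trans_le (min_le_right _ _)
    obtain ⟨a', ha'A, ha'⟩ := exists_mem_Ioo hr hΛ hrA hΛA huw
    obtain ⟨b', hb'A, hb'⟩ := exists_mem_Ioo hr hΛ hrA hΛA ha'.2
    obtain ⟨f, hf, hfo, v, hv⟩ := exists_isPL_ne_one (r := r) hΛ hΛA ha'A hb'A hb'.1
      (by linarith [hu.1, ha'.1]) (by linarith [hb'.2])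
    have hvI : v ∈ Ioo a' b' := by
      by_contra h'
      exact hv (hfo v h')
    have hfon : f ∈ onSubgroup r Λ A a b := ⟨hf, fun t ht => hfo t fun h' =>
      ht ⟨by linarith [hu.1, ha'.1, h'.1], by linarith [hb'.2, h'.2]⟩⟩
    have h1 := commute_apply (hzc f hfon) v
    have h2 := hz.strictMono (ha'.1.trans hvI.1)
    rw [hfo (z v) fun h' => by linarith [h'.2, hb'.2]] at h1
    exact hv (z.injective h1)
  rcases lt_or_gt_of_ne hne with hlt | hgt
  · refine key x⁻¹ hx.inv (fun y hy => (h y hy).inv_left) ?_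
    simpa using hx.inv.strictMono hlt
  · exact key x hx h hgt

theorem mem_inf_centralizer_singleton {G : Type*} [Group G] {K : Subgroup G} {x y : G} :
    y ∈ K ⊓ Subgroup.centralizer {x} ↔ y ∈ K ∧ Commute x y := by
  rw [Subgroup.mem_inf, Subgroup.mem_centralizer_iff]
  simp [Commute, SemiconjBy]

theorem coe_eq_FOnSet_iff (hr : 0 < r) (hrA : r ∈ A)
    (hΛA : ∀ s : PosReal, s ∈ Λ → ∀ a : ℝ, a ∈ A → (s : ℝ) * a ∈ A) {a b : ℝ}
    {K : Subgroup (Equiv.Perm ℝ)} :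
    (K : Set (Equiv.Perm ℝ)) = FOnSet r Λ A a b ↔ K = onSubgroup r Λ A a b := by
  have : FOnSet r Λ A a b = onSubgroup r Λ A a b := Set.ext (memFOn_iff hr hrA hΛA)
  rw [this, SetLike.coe_set_eq]

theorem coe_eq_centrOnSet_iff (hr : 0 < r) (hrA : r ∈ A)
    (hΛA : ∀ s : PosReal, s ∈ Λ → ∀ a : ℝ, a ∈ A → (s : ℝ) * a ∈ A) {a b : ℝ}
    {K : Subgroup (Equiv.Perm ℝ)} {x : Equiv.Perm ℝ} :
    (K : Set (Equiv.Perm ℝ)) = centrOnSet r Λ A a b x ↔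
      K = onSubgroup r Λ A a b ⊓ Subgroup.centralizer {x} := by
  have : centrOnSet r Λ A a b x =
      (onSubgroup r Λ A a b ⊓ Subgroup.centralizer {x} : Subgroup (Equiv.Perm ℝ)) :=
    Set.ext fun y => (and_congr_left' (memFOn_iff hr hrA hΛA y)).trans
      mem_inf_centralizer_singleton.symm
  rw [this, SetLike.coe_set_eq]

/-- The direct product decompositions occurring in `centralizer_characterization`. -/
def IsDecomposition (r : ℝ) (Λ : Subgroup PosReal) (A : AddSubgroup ℝ)
    (H : Subgroup (Equiv.Perm ℝ)) {n : ℕ} (αs : Fin (n + 1) → ℝ)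
    (Hs : Fin n → Subgroup (Equiv.Perm ℝ)) : Prop :=
  StrictMono αs ∧ αs 0 = 0 ∧ αs (Fin.last n) = r ∧ (∀ i, αs i ∈ A) ∧
  (∀ i j : Fin n, i ≠ j → ∀ x ∈ Hs i, ∀ y ∈ Hs j, Commute x y) ∧
  (∀ h : Equiv.Perm ℝ, h ∈ H ↔
    ∃ t : Fin n → Equiv.Perm ℝ, (∀ i, t i ∈ Hs i) ∧ h = (List.ofFn t).prod) ∧
  (∀ t t' : Fin n → Equiv.Perm ℝ, (∀ i, t i ∈ Hs i) → (∀ i, t' i ∈ Hs i) →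
    (List.ofFn t).prod = (List.ofFn t').prod → t = t') ∧
  (∀ i : Fin n, Hs i = onSubgroup r Λ A (αs i.castSucc) (αs i.succ) ∨
    ∃ x ∈ onSubgroup r Λ A (αs i.castSucc) (αs i.succ),
      Hs i = onSubgroup r Λ A (αs i.castSucc) (αs i.succ) ⊓ Subgroup.centralizer {x} ∧
      Hs i = Subgroup.zpowers x) ∧
  (∀ i j : Fin n, j.castSucc = i.succ →
    ¬ (Hs i = onSubgroup r Λ A (αs i.castSucc) (αs i.succ) ∧
       Hs j = onSubgroup r Λ A (αs j.castSucc) (αs j.succ)))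

theorem IsPL.exists_isDecomposition (hr : 0 < r) (hΛ : Λ ≠ ⊥) (hrA : r ∈ A)
    (hΛA : ∀ s : PosReal, s ∈ Λ → ∀ a : ℝ, a ∈ A → (s : ℝ) * a ∈ A)
    {H : Subgroup (Equiv.Perm ℝ)} {x : Equiv.Perm ℝ} (hx : IsPL r Λ A x)
    (hH : ∀ y, y ∈ H ↔ IsPL r Λ A y ∧ Commute x y) :
    ∃ n : ℕ, 1 ≤ n ∧ ∃ αs : Fin (n + 1) → ℝ, ∃ Hs : Fin n → Subgroup (Equiv.Perm ℝ),
      IsDecomposition r Λ A H αs Hs := by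
  classical
  obtain ⟨n, hn, αs, hα, h0, hlast, hP, hPo⟩ := exists_strictMono_enumeration hr
    (insert 0 (insert r (hx.finite_fixBoundary.toFinset.filter (· ∈ A)))) (by simp) (by simp) (by
      intro p hp
      simp only [Finset.mem_insert, Finset.mem_filter, Set.Finite.mem_toFinset] at hp
      rcases hp with rfl | rfl | hp
      · exact ⟨le_rfl, hr.le⟩
      · exact ⟨hr.le, le_rfl⟩
      · exact hx.fixBoundary_subset hp.1)
  simp only [Finset.mem_insert, Finset.mem_filter, Set.Finite.mem_toFinset] at hP hPo
  have hαA : ∀ i, αs i ∈ A := fun i => by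
    rcases hP i with h | h | h
    · rw [h]; exact zero_mem A
    · rw [h]; exact hrA
    · exact h.2
  have hlt : ∀ i : Fin n, αs i.castSucc < αs i.succ := fun i => hα Fin.castSucc_lt_succ
  have hfix : ∀ y, IsPL r Λ A y → Commute x y → ∀ i, y (αs i) = αs i := by
    intro y hy hxy i
    rcases hP i with h | h | h
    · rw [h, hy.apply_zero]
    · rw [h, hy.apply_eq_of_notMem r (by simp)]
    · exact hx.apply_eq_of_mem_fixBoundary hy hxy h.1
  have hfixx := hfix x hx (Commute.refl x)
  have hα0 : ∀ i, 0 ≤ αs i := fun i => h0 ▸ hα.monotone (Fin.zero_le i)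
  have hαr : ∀ i, αs i ≤ r := fun i => hlast ▸ hα.monotone (Fin.le_last i)
  let Hs : Fin n → Subgroup (Equiv.Perm ℝ) := fun i =>
    onSubgroup r Λ A (αs i.castSucc) (αs i.succ) ⊓ Subgroup.centralizer {x}
  have hHs : ∀ i y, y ∈ Hs i ↔
      y ∈ onSubgroup r Λ A (αs i.castSucc) (αs i.succ) ∧ Commute x y :=
    fun i y => mem_inf_centralizer_singleton
  refine ⟨n, hn, αs, Hs, hα, h0, hlast, hαA, ?_, ?_, ?_, ?_, ?_⟩
  · intro i j hij y hy z hz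
    exact commute_of_mem_onSubgroup hα hij ((hHs _ _).1 hy).1 ((hHs _ _).1 hz).1
  · intro y
    rw [hH]
    constructor
    · rintro ⟨hy, hxy⟩
      obtain ⟨t, ht, hty, hyt⟩ := hy.exists_prod_ofFn hα h0 hlast hαA (hfix y hy hxy)
      exact ⟨t, fun i => (hHs i _).2 ⟨ht i,
        commute_restrict hx hxy (hfixx _) (hfixx _) (hty i) (ht i).2⟩, hyt⟩
    · rintro ⟨t, ht, rfl⟩
      rw [← mem_plSubgroup, ← mem_inf_centralizer_singleton]
      refine Subgroup.list_prod_mem _ fun y hy => ?_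
      obtain ⟨i, rfl⟩ := (List.mem_ofFn' _ _).1 hy
      have := (hHs i _).1 (ht i)
      exact mem_inf_centralizer_singleton.2 ⟨this.1.1, this.2⟩
  · intro t t' ht ht' h
    exact eq_of_prod_ofFn_eq hα (fun i => ((hHs i _).1 (ht i)).1)
      (fun i => ((hHs i _).1 (ht' i)).1) h
  · intro i
    by_cases hid : ∀ u ∈ Ioo (αs i.castSucc) (αs i.succ), x u = u
    · refine Or.inl (Subgroup.ext fun y => (hHs i y).trans ⟨And.left, fun hy => ⟨hy, ?_⟩⟩)
      refine commute_of_disjoint fun u => ?_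
      by_cases hu : u ∈ Ioo (αs i.castSucc) (αs i.succ)
      · exact Or.inl (hid u hu)
      · exact Or.inr (hy.2 u hu)
    · push Not at hid
      obtain ⟨z, hz, hxz, hzz⟩ := hx.exists_centralizer_eq_zpowers (hlt i) (hαA _) (hαA _)
        (hfixx _) (hfixx _)
        (fun γ hγ hγA hγx => hPo γ (Or.inr (Or.inr ⟨hγx, hγA⟩)) i hγ) hid
      have h1 : Hs i = Subgroup.zpowers z := Subgroup.ext fun y => (hHs i y).trans (hxz y)
      refine Or.inr ⟨z, hz, ?_, h1⟩
      rw [h1]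
      exact Subgroup.ext fun y => ((mem_inf_centralizer_singleton).trans (hzz y)).symm
  · rintro i j hij ⟨h1, h2⟩
    have key : ∀ j : Fin n, Hs j = onSubgroup r Λ A (αs j.castSucc) (αs j.succ) →
        ∀ u ∈ Ioo (αs j.castSucc) (αs j.succ), x u = u := fun j hj =>
      apply_eq_of_forall_commute hr hΛ hrA hΛA (hα0 _) (hαr _) hx fun y hy =>
        ((hHs j y).1 (hj ▸ hy)).2
    have k1 := key i h1
    have k2 := key j h2
    have hl := hlt i
    have hl' := hlt j
    rw [hij] at k2 hl'
    rcases hP i.succ with h | h | h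
    · exact absurd (hα0 i.castSucc) (by linarith)
    · exact absurd (hαr j.succ) (by linarith)
    · refine h.1.2 ?_
      filter_upwards [Ioo_mem_nhds hl hl'] with u hu
      rcases lt_trichotomy u (αs i.succ) with h' | h' | h'
      · exact k1 u ⟨hu.1, h'⟩
      · rw [h', hfixx]
      · exact k2 u ⟨h', hu.2⟩

theorem IsDecomposition.exists_centralizer (hr : 0 < r) (hΛ : Λ ≠ ⊥) (hrA : r ∈ A)
    (hΛA : ∀ s : PosReal, s ∈ Λ → ∀ a : ℝ, a ∈ A → (s : ℝ) * a ∈ A)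
    {H : Subgroup (Equiv.Perm ℝ)} {n : ℕ} {αs : Fin (n + 1) → ℝ}
    {Hs : Fin n → Subgroup (Equiv.Perm ℝ)} (h : IsDecomposition r Λ A H αs Hs) :
    ∃ x : Equiv.Perm ℝ, IsPL r Λ A x ∧ ∀ y, y ∈ H ↔ IsPL r Λ A y ∧ Commute x y := by
  obtain ⟨hα, h0, hlast, hαA, -, hprod, -, hkind, hcons⟩ := h
  have hlt : ∀ i : Fin n, αs i.castSucc < αs i.succ := fun i => hα Fin.castSucc_lt_succ
  have hα0 : ∀ i, 0 ≤ αs i := fun i => h0 ▸ hα.monotone (Fin.zero_le i)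
  have hαr : ∀ i, αs i ≤ r := fun i => hlast ▸ hα.monotone (Fin.le_last i)
  have hex : ∀ i : Fin n, ∃ z ∈ onSubgroup r Λ A (αs i.castSucc) (αs i.succ),
      Hs i = onSubgroup r Λ A (αs i.castSucc) (αs i.succ) ⊓ Subgroup.centralizer {z} ∧
      (Hs i = onSubgroup r Λ A (αs i.castSucc) (αs i.succ) ∨ Hs i = Subgroup.zpowers z) := by
    intro i
    rcases hkind i with h | ⟨z, hz, hzc, hzp⟩
    · refine ⟨1, one_mem _, ?_, Or.inl h⟩
      rw [h]
      exact Subgroup.ext fun y =>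
        ⟨fun hy => mem_inf_centralizer_singleton.2 ⟨hy, Commute.one_left y⟩, fun hy => hy.1⟩
    · exact ⟨z, hz, hzc, Or.inr hzp⟩
  choose xs hxs hxc hxk using hex
  have hHs : ∀ i y, y ∈ Hs i ↔
      y ∈ onSubgroup r Λ A (αs i.castSucc) (αs i.succ) ∧ Commute (xs i) y := fun i y => by
    rw [hxc i]
    exact mem_inf_centralizer_singleton
  have hx : IsPL r Λ A (List.ofFn xs).prod := by
    rw [← mem_plSubgroup]
    refine Subgroup.list_prod_mem _ fun y hy => ?_
    obtain ⟨i, rfl⟩ := (List.mem_ofFn' _ _).1 hy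
    exact (hxs i).1
  have hxapply := fun i u => prod_ofFn_apply_of_mem_Icc hα hxs i (u := u)
  set x := (List.ofFn xs).prod
  have hxl : ∀ i : Fin n, x (αs i.castSucc) = αs i.castSucc := fun i => by
    rw [hxapply i _ (left_mem_Icc.2 (hlt i).le), (hxs i).2 _ (by simp)]
  have hxr : ∀ i : Fin n, x (αs i.succ) = αs i.succ := fun i => by
    rw [hxapply i _ (right_mem_Icc.2 (hlt i).le), (hxs i).2 _ (by simp)]
  have hcyc : ∀ i : Fin n, Hs i ≠ onSubgroup r Λ A (αs i.castSucc) (αs i.succ) →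
      ∀ γ ∈ Icc (αs i.castSucc) (αs i.succ), x γ = γ → γ ∈ fixBoundary x := by
    intro i hi γ hγ hγx
    have hzp := (hxk i).resolve_left hi
    refine ⟨hγx, not_eventually_of_forall_exists (hlt i) hγ fun p q hpq hsub => ?_⟩
    obtain ⟨u, hu, hne⟩ := exists_apply_ne_of_centralizer_eq_zpowers hr hΛ hrA hΛA (hα0 _) (hαr _)
      (fun y hy hc => hzp ▸ (hHs i y).2 ⟨hy, hc⟩) hpq hsub
    exact ⟨u, hu, by rwa [hxapply i u (Ioo_subset_Icc_self (hsub hu))]⟩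
  refine ⟨x, hx, fun y => ?_⟩
  rw [hprod]
  constructor
  · rintro ⟨t, ht, rfl⟩
    rw [← mem_plSubgroup, ← mem_inf_centralizer_singleton]
    refine Subgroup.list_prod_mem _ fun y hy => ?_
    obtain ⟨i, rfl⟩ := (List.mem_ofFn' _ _).1 hy
    obtain ⟨hti, hci⟩ := (hHs i _).1 (ht i)
    refine mem_inf_centralizer_singleton.2 ⟨hti.1, ?_⟩
    exact (commute_iff_of_eqOn hx (hxl i) (hxr i) (fun u hu => (hxapply i u hu).symm) (hxs i).2
      hti.1 (hti.2 _ (by simp)) (hti.2 _ (by simp))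
      fun u hu => hti.2 u fun h => hu (Ioo_subset_Icc_self h)).2 hci
  · rintro ⟨hy, hxy⟩
    have hfix : ∀ i, y (αs i) = αs i := by
      intro k
      cases k using Fin.cases with
      | zero => exact h0.symm ▸ hy.apply_zero
      | succ i =>
        cases h : i.succ using Fin.lastCases with
        | last => rw [hlast, hy.apply_eq_of_notMem r (by simp)]
        | cast j =>
          refine hx.apply_eq_of_mem_fixBoundary hy hxy ?_
          by_cases h1 : Hs i = onSubgroup r Λ A (αs i.castSucc) (αs i.succ)
          · exact hcyc j (fun h2 => hcons i j h.symm ⟨h1, h2⟩) _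
              (left_mem_Icc.2 (hlt j).le) (hxl j)
          · rw [← h]
            exact hcyc i h1 _ (right_mem_Icc.2 (hlt i).le) (hxr i)
    obtain ⟨t, ht, hty, hyt⟩ := hy.exists_prod_ofFn hα h0 hlast hαA hfix
    refine ⟨t, fun i => (hHs i _).2 ⟨ht i, ?_⟩, hyt⟩
    exact (commute_iff_of_eqOn hx (hxl i) (hxr i) (fun u hu => (hxapply i u hu).symm) (hxs i).2
      (ht i).1 ((ht i).2 _ (by simp)) ((ht i).2 _ (by simp))
      fun u hu => (ht i).2 u fun h => hu (Ioo_subset_Icc_self h)).1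
      (commute_restrict hx hxy (hxl i) (hxr i) (hty i) (ht i).2)

end PL

/-- A subgroup `H` of `F(r, Λ, A)` is the centralizer in `F(r, Λ, A)` of a
single element if and only if there are `n ≥ 1`, points `0 = α₀ < α₁ < ⋯ < α_n = r` in `A`,
and subgroups `H₁, …, H_n` such that: (1) `H` is the internal direct product of the `Hᵢ`
(they pairwise commute, generate `H`, and the product decomposition of each element of `H`
is unique); (2) each `Hᵢ` is either all of `F_{(α_{i-1}, α_i)}(r,Λ,A)`, or is the
centralizer of some `x ∈ F_{(α_{i-1}, α_i)}(r,Λ,A)` in `F_{(α_{i-1}, α_i)}(r,Λ,A)` and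
equals `⟨x⟩`; and (3) no two consecutive `Hᵢ` are both of the first kind. -/
theorem centralizer_characterization
    (r : ℝ) (hr : 0 < r) (Λ : Subgroup PosReal) (hΛ : Λ ≠ ⊥)
    (A : AddSubgroup ℝ) (hrA : r ∈ A)
    (hΛA : ∀ s : PosReal, s ∈ Λ → ∀ a : ℝ, a ∈ A → (s : ℝ) * a ∈ A)
    (H : Subgroup (Equiv.Perm ℝ))
    (hHF : (H : Set (Equiv.Perm ℝ)) ⊆ {f | MemF r Λ A f}) :
    (∃ x : Equiv.Perm ℝ, MemF r Λ A x ∧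
        (H : Set (Equiv.Perm ℝ)) = {y | MemF r Λ A y ∧ Commute x y})
      ↔
    ∃ n : ℕ, 1 ≤ n ∧ ∃ αs : Fin (n + 1) → ℝ, ∃ Hs : Fin n → Subgroup (Equiv.Perm ℝ),
      StrictMono αs ∧ αs 0 = 0 ∧ αs (Fin.last n) = r ∧ (∀ i, αs i ∈ A) ∧
      -- (1) `H` is the internal direct product of the `Hs i`
      (∀ i j : Fin n, i ≠ j → ∀ x ∈ Hs i, ∀ y ∈ Hs j, Commute x y) ∧
      (∀ h : Equiv.Perm ℝ, h ∈ H ↔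
        ∃ t : Fin n → Equiv.Perm ℝ, (∀ i, t i ∈ Hs i) ∧ h = (List.ofFn t).prod) ∧
      (∀ t t' : Fin n → Equiv.Perm ℝ, (∀ i, t i ∈ Hs i) → (∀ i, t' i ∈ Hs i) →
        (List.ofFn t).prod = (List.ofFn t').prod → t = t') ∧
      -- (2) the two possible kinds of factors
      (∀ i : Fin n,
        (Hs i : Set (Equiv.Perm ℝ)) = FOnSet r Λ A (αs i.castSucc) (αs i.succ) ∨
        ∃ x : Equiv.Perm ℝ, MemFOn r Λ A (Set.Ioo (αs i.castSucc) (αs i.succ)) x ∧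
          (Hs i : Set (Equiv.Perm ℝ)) = centrOnSet r Λ A (αs i.castSucc) (αs i.succ) x ∧
          Hs i = Subgroup.zpowers x) ∧
      -- (3) no two consecutive factors of the first kind
      (∀ i : ℕ, ∀ hi : i + 1 < n,
        ¬ ((Hs ⟨i, Nat.lt_of_succ_lt hi⟩ : Set (Equiv.Perm ℝ))
              = FOnSet r Λ A (αs ⟨i, by omega⟩) (αs ⟨i + 1, by omega⟩) ∧
           (Hs ⟨i + 1, hi⟩ : Set (Equiv.Perm ℝ))
              = FOnSet r Λ A (αs ⟨i + 1, by omega⟩) (αs ⟨i + 2, by omega⟩))) := by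
  simp only [memF_iff_isPL hr hrA hΛA, memFOn_iff hr hrA hΛA, coe_eq_FOnSet_iff hr hrA hΛA,
    coe_eq_centrOnSet_iff hr hrA hΛA]
  constructor
  · rintro ⟨x, hx, hH⟩
    obtain ⟨n, hn, αs, Hs, h1, h2, h3, h4, h5, h6, h7, h8, h9⟩ :=
      hx.exists_isDecomposition hr hΛ hrA hΛA fun y => Set.ext_iff.1 hH y
    exact ⟨n, hn, αs, Hs, h1, h2, h3, h4, h5, h6, h7, h8, fun i hi =>
      h9 ⟨i, Nat.lt_of_succ_lt hi⟩ ⟨i + 1, hi⟩ rfl⟩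
  · rintro ⟨n, -, αs, Hs, h1, h2, h3, h4, h5, h6, h7, h8, h9⟩
    have h : IsDecomposition r Λ A H αs Hs := by
      refine ⟨h1, h2, h3, h4, h5, h6, h7, h8, ?_⟩
      rintro i ⟨j, hj⟩ hij
      obtain rfl : j = i + 1 := congrArg Fin.val hij
      exact h9 i hj
    obtain ⟨x, hx, hH⟩ := h.exists_centralizer hr hΛ hrA hΛA
    exact ⟨x, hx, Set.ext hH⟩

end ThompsonStein
end
end
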